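/- arXiv:0712.3865 — 2 statements merged into one kernel-verified Lean document; each statement's English description precedes it below -/
import Mathlib

section
/- Let n ≥ 3 be an odd integer, set m = (n−3)/2, and let 0 < ε < 1. Then there is a constant C = C(n, ε) such that for every N ≥ 3, all real s₁, …, s_N with m ≤ s_j ≤ m + 1 − ε for each j, every γ > 0 and every ξ ∈ ℝⁿ, T_{N,γ}(ξ; s₁, …, s_N) ≤ (C/2) γ^{-1} ⟨ξ⟩^{2m − 2s₁} T_{N-1,γ}(ξ; s₂, …, s_N) + (C/2) γ^{-1} ⟨ξ⟩^{2m − 2s₂} T_{N-1,γ}(ξ; s₁, s₃, …, s_N). -/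
open MeasureTheory Finset

/-- `hfun γ r s = (γ + |r-s|)⁻¹ (γ + |r+s|)⁻¹`. -/
noncomputable def hfun (γ r s : ℝ) : ℝ := (γ + |r - s|)⁻¹ * (γ + |r + s|)⁻¹

/-- The Japanese bracket `⟨x⟩ = (1 + |x|²)^{1/2}` of a vector. -/
noncomputable def jap {E : Type*} [NormedAddCommGroup E] (x : E) : ℝ :=
  Real.sqrt (1 + ‖x‖ ^ 2)

/-- `Mfun N s ξ = ⟨ξ₀+ξ_{N-1}⟩^{-s₀} ⟨ξ₁-ξ₀⟩^{-s₁} ⋯ ⟨ξ_{N-1}-ξ_{N-2}⟩^{-s_{N-1}}`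
(the function `M_{s₁,…,s_N}(ξ₁,…,ξ_N)` of the paper, with indices shifted to start at `0`). -/
noncomputable def Mfun {E : Type*} [NormedAddCommGroup E] (N : ℕ) (s : ℕ → ℝ) (ξ : ℕ → E) : ℝ :=
  jap (ξ 0 + ξ (N - 1)) ^ (-(s 0)) * ∏ j ∈ Finset.Ico 1 N, jap (ξ j - ξ (j - 1)) ^ (-(s j))

/-- `Tfun n N γ ξ s = ∫_{(ℝⁿ)^{N-1}} (∏_j h_γ(|ξ_j|,|ξ|))² M_s(ξ₁,…,ξ_{N-1},ξ)² dξ₁⋯dξ_{N-1}`. -/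
noncomputable def Tfun (n N : ℕ) (γ : ℝ) (ξ : EuclideanSpace ℝ (Fin n)) (s : ℕ → ℝ) : ℝ :=
  ∫ y : Fin (N - 1) → EuclideanSpace ℝ (Fin n),
    (∏ j : Fin (N - 1), hfun γ ‖y j‖ ‖ξ‖) ^ 2 *
      Mfun N s (fun j => if h : j < N - 1 then y ⟨j, h⟩ else ξ) ^ 2


lemma aux_polar {E : Type*} [NormedAddCommGroup E] [NormedSpace ℝ E] [MeasurableSpace E]
    [BorelSpace E] [FiniteDimensional ℝ E] [Nontrivial E] (μ : Measure E) [μ.IsAddHaarMeasure]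
    (F : ℝ → ENNReal) (hF : Measurable F) (Θ : E → ENNReal) (hΘ : Measurable Θ)
    (hom : ∀ t : ℝ, 0 < t → ∀ x, Θ (t • x) = Θ x) :
    ∫⁻ x, F ‖x‖ * Θ x ∂μ = (∫⁻ w : Metric.sphere (0:E) 1, Θ w ∂μ.toSphere) *
      ∫⁻ ρ in Set.Ioi (0:ℝ), ENNReal.ofReal (ρ ^ (Module.finrank ℝ E - 1)) * F ρ := by
  calc ∫⁻ x, F ‖x‖ * Θ x ∂μ
      = ∫⁻ x : ({(0)}ᶜ : Set E), F ‖x.1‖ * Θ x.1 ∂(μ.comap (↑)) := by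
        rw [lintegral_subtype_comap (measurableSet_singleton _).compl (fun x => F ‖x‖ * Θ x),
          restrict_compl_singleton]
    _ = ∫⁻ x, Θ x.1 * F x.2 ∂(μ.toSphere.prod (.volumeIoiPow (Module.finrank ℝ E - 1))) := by
        rw [← μ.measurePreserving_homeomorphUnitSphereProd.lintegral_comp_emb
          (Homeomorph.measurableEmbedding _)]
        refine lintegral_congr fun x => ?_
        have hx : 0 < ‖x.1‖ := norm_pos_iff.2 x.2
        simp only [homeomorphUnitSphereProd_apply_snd_coe, homeomorphUnitSphereProd_apply_fst_coe]
        rw [hom _ (inv_pos.2 hx), mul_comm]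
    _ = (∫⁻ w : Metric.sphere (0:E) 1, Θ w ∂μ.toSphere) *
        ∫⁻ ρ : Set.Ioi (0:ℝ), F ρ ∂(.volumeIoiPow (Module.finrank ℝ E - 1)) := by
        rw [lintegral_prod_mul (f := fun w : Metric.sphere (0:E) 1 => Θ w)
          (g := fun ρ : Set.Ioi (0:ℝ) => F ρ)]
        · exact (hΘ.comp measurable_subtype_coe).aemeasurable
        · exact (hF.comp measurable_subtype_coe).aemeasurable
    _ = _ := by
        congr 1
        rw [Measure.volumeIoiPow, lintegral_withDensity_eq_lintegral_mul]
        · simp only [Pi.mul_apply]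
          rw [lintegral_subtype_comap measurableSet_Ioi
            (fun ρ => ENNReal.ofReal (ρ ^ (Module.finrank ℝ E - 1)) * F ρ)]
        · fun_prop
        · exact (hF.comp measurable_subtype_coe)

lemma aux_lint_prod (k : ℕ) (f : Fin k → ℝ → ENNReal) (hf : ∀ i, Measurable (f i)) :
    ∫⁻ x : Fin k → ℝ, ∏ i, f i (x i) = ∏ i, ∫⁻ t, f i t := by
  induction k with
  | zero =>
    rw [volume_pi, Measure.pi_of_empty]
    simp
  | succ k ih =>
    rw [← (volume_preserving_piFinSuccAbove (fun _ : Fin (k+1) => ℝ) 0).symm.lintegral_comp_emb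
      (MeasurableEquiv.measurableEmbedding _)]
    rw [Fin.prod_univ_succ, ← ih (fun i => f i.succ) (fun i => hf _)]
    rw [← lintegral_prod_mul (hf 0).aemeasurable, ← Measure.volume_eq_prod]
    · refine lintegral_congr fun x => ?_
      simp [Fin.prod_univ_succ, MeasurableEquiv.piFinSuccAbove]
    · exact (Finset.measurable_prod _ (fun i _ => (hf i.succ).comp (measurable_pi_apply i))).aemeasurable

noncomputable def auxΘ (d : ℕ) (b : ℝ) (x : EuclideanSpace ℝ (Fin (d+1))) : ENNReal :=
  ∏ j : Fin d, (ENNReal.ofReal (|x j.succ| / ‖x‖)) ^ (-b)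

lemma auxΘ_meas (d : ℕ) (b : ℝ) : Measurable (auxΘ d b) := by
  unfold auxΘ
  fun_prop

lemma auxΘ_hom (d : ℕ) (b : ℝ) (t : ℝ) (ht : 0 < t) (x : EuclideanSpace ℝ (Fin (d+1))) :
    auxΘ d b (t • x) = auxΘ d b x := by
  unfold auxΘ
  refine Finset.prod_congr rfl fun j _ => ?_
  congr 2
  simp [norm_smul, abs_mul, abs_of_pos ht]
  rw [mul_div_mul_left _ _ ht.ne']

lemma aux_one_dim (b : ℝ) (hb : b < 1) :
    ∫⁻ t : ℝ in Set.Icc (-1) 1, (ENNReal.ofReal |t|) ^ (-b) < ⊤ := by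
  have h1 : IntegrableOn (fun t : ℝ => |t| ^ (-b)) (Set.Icc (-1) 1) := by
    have h : IntegrableOn (fun t : ℝ => |t| ^ (-b)) (Set.Icc 0 1) := by
      have := (intervalIntegral.intervalIntegrable_rpow' (a := 0) (b := 1) (r := -b) (by linarith))
      rw [intervalIntegrable_iff_integrableOn_Icc_of_le (by norm_num)] at this
      refine this.congr_fun (fun t ht => ?_) measurableSet_Icc
      simp [abs_of_nonneg ht.1]
    have h' : IntegrableOn (fun t : ℝ => |t| ^ (-b)) (Set.Icc (-1) 0) := by
      have := h.comp_neg
      simpa using this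
    have := h'.union h
    rwa [Set.Icc_union_Icc_eq_Icc (by norm_num) (by norm_num)] at this
  have h2 := h1.lintegral_lt_top
  refine lt_of_eq_of_lt (lintegral_congr_ae ?_) h2
  refine ae_restrict_of_ae ?_
  have : ∀ᵐ t : ℝ, t ≠ 0 := by simp [ae_iff]
  filter_upwards [this] with t ht
  rw [ENNReal.ofReal_rpow_of_pos (abs_pos.2 ht)]

lemma aux_ballint (d : ℕ) (b : ℝ) (hb0 : 0 < b) (hb : b < 1) :
    ∫⁻ x : EuclideanSpace ℝ (Fin (d+1)), (Set.Iio (1:ℝ)).indicator 1 ‖x‖ * auxΘ d b x < ⊤ := by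
  let g : Fin (d+1) → ℝ → ENNReal := Fin.cons ((Set.Icc (-1:ℝ) 1).indicator 1)
    (fun _ => (Set.Icc (-1:ℝ) 1).indicator (fun t => (ENNReal.ofReal |t|) ^ (-b)))
  have hg : ∀ i, Measurable (g i) := by
    intro i
    refine Fin.cases ?_ (fun j => ?_) i
    · exact measurable_one.indicator measurableSet_Icc
    · simp only [g, Fin.cons_succ]
      exact Measurable.indicator (by fun_prop) measurableSet_Icc
  have hfin : ∫⁻ x : Fin (d+1) → ℝ, ∏ i, g i (x i) < ⊤ := by
    rw [aux_lint_prod _ _ hg]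
    refine ENNReal.prod_lt_top fun i _ => ?_
    refine Fin.cases ?_ (fun j => ?_) i
    · simp only [g, Fin.cons_zero]
      rw [lintegral_indicator measurableSet_Icc]
      simp
    · simp only [g, Fin.cons_succ]
      rw [lintegral_indicator measurableSet_Icc]
      exact aux_one_dim b hb
  refine lt_of_le_of_lt ?_ hfin
  have hm : Measurable (fun x : Fin (d+1) → ℝ => ∏ i, g i (x i)) :=
    Finset.measurable_prod _ (fun i _ => (hg i).comp (measurable_pi_apply i))
  rw [← (PiLp.volume_preserving_ofLp (Fin (d+1))).lintegral_comp hm]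
  refine lintegral_mono fun x => ?_
  by_cases hx : ‖x‖ < 1
  · have hc : ∀ i, |x i| ≤ ‖x‖ := fun i => by
      simpa using PiLp.norm_apply_le x i
    have hi : ∀ i, x i ∈ Set.Icc (-1:ℝ) 1 := fun i => by
      rw [Set.mem_Icc, ← abs_le]; linarith [hc i]
    simp only [Set.mem_Iio, hx, Set.indicator_of_mem, Pi.one_apply, one_mul, auxΘ]
    rw [Fin.prod_univ_succ]
    simp only [g, Fin.cons_zero, Fin.cons_succ, Set.indicator_of_mem (hi _), Pi.one_apply, one_mul]
    refine Finset.prod_le_prod' fun j _ => ?_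
    rw [ENNReal.rpow_neg, ENNReal.rpow_neg, ENNReal.inv_le_inv]
    refine ENNReal.rpow_le_rpow (ENNReal.ofReal_le_ofReal ?_) hb0.le
    rcases (norm_nonneg x).eq_or_lt with h0 | h0
    · have := hc j.succ
      rw [← h0] at this ⊢
      simpa using this
    · rw [le_div_iff₀ h0]
      nlinarith [abs_nonneg (x j.succ)]
  · simp [hx]

lemma aux_sphere_fin (d : ℕ) (b : ℝ) (hb0 : 0 < b) (hb : b < 1) :
    ∫⁻ w : Metric.sphere (0:EuclideanSpace ℝ (Fin (d+1))) 1, auxΘ d b w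
      ∂(volume : Measure (EuclideanSpace ℝ (Fin (d+1)))).toSphere < ⊤ := by
  have h := aux_ballint d b hb0 hb
  rw [aux_polar volume _ (measurable_one.indicator measurableSet_Iio) _ (auxΘ_meas d b)
    (auxΘ_hom d b)] at h
  rcases ENNReal.mul_lt_top_iff.1 h with h | h | h
  · exact h.1
  · rw [h]; simp
  · exfalso
    revert h
    rw [lintegral_eq_zero_iff]
    · intro h
      have h3 := (ae_restrict_iff' measurableSet_Ioi).1 h
      have h2 : (volume : Measure ℝ) (Set.Ioo 0 1) = 0 := by
        refine measure_mono_null ?_ h3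
        intro t ht h4
        have := h4 ht.1
        simp [ht.2] at this
        have h5 : (0:ℝ) < t ^ d := pow_pos ht.1 d
        linarith
      simp at h2
    · refine Measurable.mul (by fun_prop) (measurable_one.indicator measurableSet_Iio)

lemma aux_radial (γ r : ℝ) (hγ : 0 < γ) :
    ∫⁻ ρ : ℝ, ENNReal.ofReal ((γ ^ 2 + (ρ - r) ^ 2)⁻¹) = ENNReal.ofReal (Real.pi * γ⁻¹) := by
  rw [lintegral_sub_right_eq_self (fun x : ℝ => ENNReal.ofReal ((γ ^ 2 + x ^ 2)⁻¹)) r]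
  have e : (fun x : ℝ => (γ ^ 2 + x ^ 2)⁻¹) = fun x => (γ ^ 2)⁻¹ * (1 + (x / γ) ^ 2)⁻¹ := by
    funext x
    rw [← mul_inv]
    congr 1
    field_simp
  have hi : Integrable (fun x : ℝ => (γ ^ 2 + x ^ 2)⁻¹) := by
    rw [e]
    exact (integrable_inv_one_add_sq.comp_div hγ.ne').const_mul _
  rw [← ofReal_integral_eq_lintegral_ofReal hi (Filter.Eventually.of_forall fun x => by positivity)]
  congr 1
  rw [e, integral_const_mul, Measure.integral_comp_div (fun x : ℝ => (1 + x ^ 2)⁻¹),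
    integral_univ_inv_one_add_sq, abs_of_pos hγ, smul_eq_mul]
  field_simp

lemma aux_jap_one_le {E : Type*} [NormedAddCommGroup E] (x : E) : 1 ≤ jap x := by
  unfold jap
  rw [Real.one_le_sqrt]
  nlinarith [sq_nonneg ‖x‖]

lemma aux_jap_pos {E : Type*} [NormedAddCommGroup E] (x : E) : 0 < jap x :=
  lt_of_lt_of_le one_pos (aux_jap_one_le x)

lemma aux_jap_sq {E : Type*} [NormedAddCommGroup E] (x : E) : jap x ^ 2 = 1 + ‖x‖ ^ 2 := by
  unfold jap
  rw [Real.sq_sqrt]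
  positivity

lemma aux_jap_mono {E F : Type*} [NormedAddCommGroup E] [NormedAddCommGroup F] {x : E} {y : F}
    (h : ‖x‖ ≤ ‖y‖) : jap x ≤ jap y := by
  unfold jap
  gcongr

lemma aux_jap_cont {E : Type*} [NormedAddCommGroup E] : Continuous (jap : E → ℝ) := by
  unfold jap
  fun_prop

/-- pointwise radial bound -/
lemma aux_rad_pt (m : ℕ) (s γ r ρ : ℝ) (hs : (m : ℝ) ≤ s) (hs' : s ≤ m + 1) (hγ : 0 < γ)
    (hr : 0 ≤ r) (hρ : 0 < ρ) :
    ρ ^ (2 * m + 2) * jap ρ ^ (-(2 * s)) ≤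
      2 * jap r ^ (2 * (m : ℝ) - 2 * s) * (γ + (ρ + r)) ^ 2 := by
  have hP := aux_jap_pos ρ
  have hP1 := aux_jap_one_le ρ
  have hQ := aux_jap_pos r
  have hQ1 := aux_jap_one_le r
  have hPs := aux_jap_sq ρ
  have hQs := aux_jap_sq r
  rw [Real.norm_eq_abs, sq_abs] at hPs hQs
  set P := jap ρ
  set Q := jap r
  have hρP : ρ ≤ P := by nlinarith
  have h1 : ρ ^ (2 * m + 2) * P ^ (-(2 * s)) ≤ ρ ^ 2 * P ^ (2 * (m : ℝ) - 2 * s) := by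
    have : P ^ (2 * (m : ℝ) - 2 * s) = P ^ (2 * m) * P ^ (-(2 * s)) := by
      rw [sub_eq_add_neg, Real.rpow_add hP]
      congr 1
      rw [← Real.rpow_natCast]; push_cast; rfl
    rw [this, pow_add, mul_comm (ρ ^ (2 * m)), mul_assoc]
    gcongr
  refine h1.trans ?_
  set u := 2 * (m : ℝ) - 2 * s with hu
  have hu0 : u ≤ 0 := by linarith
  have hu2 : -2 ≤ u := by linarith
  have hsum : ρ ^ 2 ≤ (γ + (ρ + r)) ^ 2 := by gcongr; linarith
  have hQu : 0 < Q ^ u := Real.rpow_pos_of_pos hQ _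
  have hPu : 0 < P ^ u := Real.rpow_pos_of_pos hP _
  rcases le_total r ρ with hrρ | hrρ
  · have : P ^ u ≤ Q ^ u := by
      refine Real.rpow_le_rpow_of_nonpos hQ (aux_jap_mono ?_) hu0
      rw [Real.norm_eq_abs, Real.norm_eq_abs, abs_of_nonneg hr, abs_of_pos hρ]; exact hrρ
    calc ρ ^ 2 * P ^ u ≤ (γ + (ρ + r)) ^ 2 * Q ^ u := by gcongr
      _ ≤ 2 * Q ^ u * (γ + (ρ + r)) ^ 2 := by nlinarith [mul_nonneg (sq_nonneg (γ + (ρ + r))) hQu.le]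
  · rcases le_total r 1 with hr1 | hr1
    · have h2 : P ^ u ≤ 1 := Real.rpow_le_one_of_one_le_of_nonpos hP1 hu0
      have h3 : 1 ≤ 2 * Q ^ u := by
        have : Q ^ (-2 : ℝ) ≤ Q ^ u := Real.rpow_le_rpow_of_exponent_le hQ1 hu2
        rw [Real.rpow_neg hQ.le] at this
        have e : Q ^ (2 : ℝ) = 1 + r ^ 2 := by rw [← hQs]; exact Real.rpow_two Q
        rw [e] at this
        have : (2 : ℝ)⁻¹ ≤ (1 + r ^ 2)⁻¹ := by gcongr; nlinarith
        linarith
      calc ρ ^ 2 * P ^ u ≤ (γ + (ρ + r)) ^ 2 * 1 := by gcongr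
        _ ≤ (γ + (ρ + r)) ^ 2 * (2 * Q ^ u) := by gcongr
        _ = _ := by ring
    · have h2 : P ^ 2 * P ^ u ≤ Q ^ 2 * Q ^ u := by
        rw [← Real.rpow_two, ← Real.rpow_two, ← Real.rpow_add hP, ← Real.rpow_add hQ]
        refine Real.rpow_le_rpow hP.le (aux_jap_mono ?_) (by linarith)
        rw [Real.norm_eq_abs, Real.norm_eq_abs, abs_of_nonneg hr, abs_of_pos hρ]; exact hrρ
      calc ρ ^ 2 * P ^ u ≤ P ^ 2 * P ^ u := by gcongr
        _ ≤ Q ^ 2 * Q ^ u := h2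
        _ ≤ (2 * (γ + (ρ + r)) ^ 2) * Q ^ u := by
          gcongr
          nlinarith [mul_pos hγ hρ]
        _ = _ := by ring

lemma aux_rad_pt2 (m : ℕ) (s γ r ρ : ℝ) (hs : (m : ℝ) ≤ s) (hs' : s ≤ m + 1) (hγ : 0 < γ)
    (hr : 0 ≤ r) (hρ : 0 < ρ) :
    ρ ^ (2 * m + 2) * (hfun γ ρ r ^ 2 * jap ρ ^ (-(2 * s))) ≤
      2 * jap r ^ (2 * (m : ℝ) - 2 * s) * (γ ^ 2 + (ρ - r) ^ 2)⁻¹ := by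
  have h := aux_rad_pt m s γ r ρ hs hs' hγ hr hρ
  unfold hfun
  rw [abs_of_pos (show 0 < ρ + r by linarith)]
  have hQu : 0 < jap r ^ (2 * (m : ℝ) - 2 * s) := Real.rpow_pos_of_pos (aux_jap_pos r) _
  have hb : 0 < γ + (ρ + r) := by linarith
  have h2 : ((γ + |ρ - r|)⁻¹) ^ 2 ≤ (γ ^ 2 + (ρ - r) ^ 2)⁻¹ := by
    rw [inv_pow]
    have := abs_nonneg (ρ - r)
    gcongr
    rw [← sq_abs (ρ - r)]
    nlinarith [mul_nonneg hγ.le this]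
  calc _ = (ρ ^ (2 * m + 2) * jap ρ ^ (-(2 * s))) * (((γ + |ρ - r|)⁻¹) ^ 2 * ((γ + (ρ + r))⁻¹) ^ 2) := by ring
    _ ≤ (2 * jap r ^ (2 * (m : ℝ) - 2 * s) * (γ + (ρ + r)) ^ 2) *
        ((γ ^ 2 + (ρ - r) ^ 2)⁻¹ * ((γ + (ρ + r))⁻¹) ^ 2) := by gcongr
    _ = _ := by field_simp

lemma aux_pt (d : ℕ) (hd : 0 < d) (b s : ℝ) (hb : 0 < b) (hs : 0 ≤ s) (hsb : 2 * s ≤ b * d)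
    (x z : EuclideanSpace ℝ (Fin (d+1))) (hz : ∀ j : Fin d, z j.succ = 0) :
    ENNReal.ofReal (jap (x - z) ^ (-(2 * s))) ≤
      ENNReal.ofReal (jap ‖x‖ ^ (-(2 * s))) * auxΘ d b x := by
  have hd' : (0:ℝ) < d := by exact_mod_cast hd
  have hA := aux_jap_pos (x - z)
  have hB := aux_jap_pos ‖x‖
  set q := jap (x - z) / jap ‖x‖ with hq
  have hq0 : 0 < q := div_pos hA hB
  have e1 : jap (x - z) ^ (-(2 * s)) = jap ‖x‖ ^ (-(2 * s)) * q ^ (-(2 * s)) := by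
    rw [← Real.mul_rpow hB.le hq0.le, hq, mul_div_cancel₀ _ hB.ne']
  rw [e1, ENNReal.ofReal_mul (by positivity)]
  gcongr
  have e2 : ENNReal.ofReal (q ^ (-(2 * s))) = ∏ j : Fin d, ENNReal.ofReal (q ^ (-(2 * s / d))) := by
    rw [Finset.prod_const, Finset.card_univ, Fintype.card_fin, ← ENNReal.ofReal_pow (by positivity),
      ← Real.rpow_mul_natCast hq0.le]
    congr 2
    field_simp
  rw [e2, auxΘ]
  refine Finset.prod_le_prod' fun j _ => ?_
  have hc : |x j.succ| ≤ ‖x‖ := by simpa using PiLp.norm_apply_le x j.succ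
  rcases (abs_nonneg (x j.succ)).eq_or_lt with h0 | h0
  · rw [← h0]
    simp [hb]
  · have hx : 0 < ‖x‖ := h0.trans_le hc
    have ht : 0 < |x j.succ| / ‖x‖ := div_pos h0 hx
    have ht1 : |x j.succ| / ‖x‖ ≤ 1 := by rw [div_le_one hx]; exact hc
    rw [ENNReal.ofReal_rpow_of_pos ht]
    refine ENNReal.ofReal_le_ofReal ?_
    have htq : |x j.succ| / ‖x‖ ≤ q := by
      rw [hq, div_le_div_iff₀ hx hB]
      have hc2 : |x j.succ| ≤ ‖x - z‖ := by
        have := PiLp.norm_apply_le (x - z) j.succ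
        simpa [hz] using this
      have h3 := aux_jap_sq (x - z)
      have h4 := aux_jap_sq ‖x‖
      rw [norm_norm] at h4
      refine le_of_sq_le_sq ?_ (by positivity)
      rw [mul_pow, mul_pow, h3, h4]
      nlinarith [mul_le_mul hc hc h0.le hx.le, mul_le_mul hc2 hc2 h0.le (norm_nonneg _), sq_nonneg ‖x‖]
    calc q ^ (-(2 * s / d)) ≤ (|x j.succ| / ‖x‖) ^ (-(2 * s / d)) :=
          Real.rpow_le_rpow_of_nonpos ht htq (by rw [neg_nonpos]; positivity)
      _ ≤ (|x j.succ| / ‖x‖) ^ (-b) := by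
          refine Real.rpow_le_rpow_of_exponent_ge ht ht1 ?_
          rw [neg_le_neg_iff, div_le_iff₀ hd']; exact hsb

lemma aux_hfun_cont {X : Type*} [TopologicalSpace X] (γ r : ℝ) (hγ : 0 < γ) (f : X → ℝ)
    (hf : Continuous f) : Continuous fun x => hfun γ (f x) r := by
  unfold hfun
  refine Continuous.mul ?_ ?_
  · refine Continuous.inv₀ (by fun_prop) (fun x => ?_)
    positivity
  · refine Continuous.inv₀ (by fun_prop) (fun x => ?_)
    positivity

lemma aux_japr_cont {X E : Type*} [TopologicalSpace X] [NormedAddCommGroup E] (a : ℝ) (f : X → E)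
    (hf : Continuous f) : Continuous fun x => jap (f x) ^ a :=
  Continuous.rpow_const (aux_jap_cont.comp hf) (fun x => Or.inl (aux_jap_pos _).ne')

lemma aux_key_special (m : ℕ) (ε : ℝ) (hε : 0 < ε) (hε1 : ε < 1) :
    ∃ C : ℝ, 0 ≤ C ∧ ∀ s : ℝ, (m : ℝ) ≤ s → s ≤ m + 1 - ε → ∀ γ : ℝ, 0 < γ →
      ∀ r : ℝ, 0 ≤ r → ∀ z : EuclideanSpace ℝ (Fin (2 * m + 2 + 1)), (∀ j : Fin (2*m+2), z j.succ = 0) →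
      ∫⁻ x : EuclideanSpace ℝ (Fin (2 * m + 2 + 1)),
        ENNReal.ofReal (hfun γ ‖x‖ r ^ 2 * jap (x - z) ^ (-(2 * s))) ≤
      ENNReal.ofReal (C * γ⁻¹ * jap r ^ (2 * (m : ℝ) - 2 * s)) := by
  have hm : (0:ℝ) < m + 1 := by positivity
  have hm0 : (0:ℝ) ≤ m := by positivity
  set b : ℝ := (m + 1 - ε) / (m + 1) with hbdef
  have hb0 : 0 < b := div_pos (by linarith) hm
  have hb1 : b < 1 := by rw [hbdef, div_lt_one hm]; linarith
  have hK := aux_sphere_fin (2 * m + 2) b hb0 hb1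
  set K := ∫⁻ w : Metric.sphere (0:EuclideanSpace ℝ (Fin (2*m+2+1))) 1, auxΘ (2*m+2) b w
      ∂(volume : Measure (EuclideanSpace ℝ (Fin (2*m+2+1)))).toSphere with hKdef
  refine ⟨K.toReal * (2 * Real.pi), by positivity, ?_⟩
  intro s hs hs' γ hγ r hr z hz
  have hFc : Continuous fun ρ : ℝ => hfun γ ρ r ^ 2 * jap ρ ^ (-(2 * s)) :=
    ((aux_hfun_cont γ r hγ _ continuous_id).pow 2).mul (aux_japr_cont _ _ continuous_id)
  have hJ : 0 < jap r ^ (2 * (m : ℝ) - 2 * s) := Real.rpow_pos_of_pos (aux_jap_pos r) _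
  calc ∫⁻ x : EuclideanSpace ℝ (Fin (2 * m + 2 + 1)),
        ENNReal.ofReal (hfun γ ‖x‖ r ^ 2 * jap (x - z) ^ (-(2 * s)))
      ≤ ∫⁻ x : EuclideanSpace ℝ (Fin (2 * m + 2 + 1)),
        (fun ρ => ENNReal.ofReal (hfun γ ρ r ^ 2 * jap ρ ^ (-(2 * s)))) ‖x‖ * auxΘ (2*m+2) b x := by
        refine lintegral_mono fun x => ?_
        dsimp only
        rw [ENNReal.ofReal_mul (by positivity), ENNReal.ofReal_mul (by positivity), mul_assoc]
        gcongr
        refine aux_pt _ (by omega) b s hb0 (by linarith) ?_ x z hz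
        push_cast
        rw [hbdef]
        have : (m + 1 - ε) / ((m:ℝ) + 1) * (2 * m + 2) = 2 * (m + 1 - ε) := by field_simp
        rw [this]; linarith
    _ = K * ∫⁻ ρ in Set.Ioi (0:ℝ), ENNReal.ofReal (ρ ^ (2 * m + 2)) *
          ENNReal.ofReal (hfun γ ρ r ^ 2 * jap ρ ^ (-(2 * s))) := by
        rw [aux_polar volume (fun ρ => ENNReal.ofReal (hfun γ ρ r ^ 2 * jap ρ ^ (-(2 * s))))
          hFc.measurable.ennreal_ofReal (auxΘ (2 * m + 2) b) (auxΘ_meas _ b) (auxΘ_hom _ b)]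
        simp [hKdef]
    _ ≤ K * ∫⁻ ρ in Set.Ioi (0:ℝ), ENNReal.ofReal (2 * jap r ^ (2 * (m : ℝ) - 2 * s)) *
          ENNReal.ofReal ((γ ^ 2 + (ρ - r) ^ 2)⁻¹) := by
        gcongr 1
        refine setLIntegral_mono' measurableSet_Ioi fun ρ hρ => ?_
        have hρ' : 0 < ρ := hρ
        rw [← ENNReal.ofReal_mul (by positivity), ← ENNReal.ofReal_mul (by positivity)]
        exact ENNReal.ofReal_le_ofReal (aux_rad_pt2 m s γ r ρ hs (by linarith) hγ hr hρ')
    _ ≤ K * ∫⁻ ρ : ℝ, ENNReal.ofReal (2 * jap r ^ (2 * (m : ℝ) - 2 * s)) *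
          ENNReal.ofReal ((γ ^ 2 + (ρ - r) ^ 2)⁻¹) := by
        gcongr 1
        exact setLIntegral_le_lintegral _ _
    _ = ENNReal.ofReal (K.toReal) * (ENNReal.ofReal (2 * jap r ^ (2 * (m : ℝ) - 2 * s)) *
          ENNReal.ofReal (Real.pi * γ⁻¹)) := by
        rw [lintegral_const_mul _ (by fun_prop), aux_radial γ r hγ, ENNReal.ofReal_toReal hK.ne]
    _ = _ := by
        rw [← ENNReal.ofReal_mul (by positivity), ← ENNReal.ofReal_mul (by positivity)]
        congr 1
        ring

lemma aux_key (m : ℕ) (ε : ℝ) (hε : 0 < ε) (hε1 : ε < 1) :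
    ∃ C : ℝ, 0 ≤ C ∧ ∀ s : ℝ, (m : ℝ) ≤ s → s ≤ m + 1 - ε → ∀ γ : ℝ, 0 < γ →
      ∀ ξ z : EuclideanSpace ℝ (Fin (2 * m + 3)),
      ∫⁻ x : EuclideanSpace ℝ (Fin (2 * m + 3)),
        ENNReal.ofReal (hfun γ ‖x‖ ‖ξ‖ ^ 2 * jap (x - z) ^ (-(2 * s))) ≤
      ENNReal.ofReal (C * γ⁻¹ * jap ξ ^ (2 * (m : ℝ) - 2 * s)) := by
  obtain ⟨C, hC, h⟩ := aux_key_special m ε hε hε1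
  refine ⟨C, hC, fun s hs hs' γ hγ ξ z => ?_⟩
  let w : EuclideanSpace ℝ (Fin (2 * m + 3)) := EuclideanSpace.single 0 ‖z‖
  have hw : ‖z‖ = ‖w‖ := by simp [w]
  let R := (ℝ ∙ (z - w))ᗮ.reflection
  have hR : R z = w := Submodule.reflection_sub hw
  have h1 := h s hs hs' γ hγ ‖ξ‖ (norm_nonneg _) w (fun j => by simp [w])
  have e : jap ‖ξ‖ = jap ξ := by unfold jap; rw [norm_norm]
  rw [e] at h1
  refine le_of_eq_of_le ?_ h1
  symm
  rw [← R.measurePreserving.lintegral_comp_emb R.toHomeomorph.measurableEmbedding]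
  refine lintegral_congr fun x => ?_
  have e2 : jap (R x - w) = jap (x - z) := by
    unfold jap
    rw [← hR, ← map_sub, R.norm_map]
  rw [e2, R.norm_map]

lemma aux_split {E : Type*} [NormedAddCommGroup E] (m : ℕ) (s t : ℝ) (hs0 : 0 ≤ s) (hs : s ≤ m + 1)
    (ht0 : 0 ≤ t) (ht : t ≤ m + 1) (u v : E) :
    jap u ^ (-(2 * s)) * jap v ^ (-(2 * t)) ≤ (4 : ℝ) ^ (m + 1) *
      (jap v ^ (-(2 * t)) * jap (u + v) ^ (-(2 * s)) +
        jap u ^ (-(2 * s)) * jap (u + v) ^ (-(2 * t))) := by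
  have key : ∀ a : E, ∀ p : ℝ, 0 ≤ p → p ≤ m + 1 → jap (u + v) ≤ 2 * jap a →
      jap a ^ (-(2 * p)) ≤ (4 : ℝ) ^ (m + 1) * jap (u + v) ^ (-(2 * p)) := by
    intro a p hp0 hp h
    have hD := aux_jap_pos (u + v)
    have hA := aux_jap_pos a
    have h1 : (2 * jap a) ^ (-(2 * p)) ≤ jap (u + v) ^ (-(2 * p)) :=
      Real.rpow_le_rpow_of_nonpos hD h (by linarith)
    have h2 : jap a ^ (-(2 * p)) = 2 ^ (2 * p) * (2 * jap a) ^ (-(2 * p)) := by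
      rw [Real.mul_rpow (by norm_num) hA.le, ← mul_assoc, ← Real.rpow_add (by norm_num)]
      simp
    have h3 : (2 : ℝ) ^ (2 * p) ≤ (4 : ℝ) ^ (m + 1) := by
      rw [Real.rpow_mul (by norm_num), Real.rpow_two, ← Real.rpow_natCast (4:ℝ)]
      have : (2:ℝ) ^ 2 = 4 := by norm_num
      rw [this]
      push_cast
      exact Real.rpow_le_rpow_of_exponent_le (by norm_num) hp
    rw [h2]
    have := Real.rpow_pos_of_pos hD (-(2 * p))
    gcongr
  have hu := Real.rpow_pos_of_pos (aux_jap_pos u) (-(2 * s))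
  have hv := Real.rpow_pos_of_pos (aux_jap_pos v) (-(2 * t))
  have hs' := Real.rpow_pos_of_pos (aux_jap_pos (u + v)) (-(2 * s))
  have ht' := Real.rpow_pos_of_pos (aux_jap_pos (u + v)) (-(2 * t))
  have hmax : jap (u + v) ≤ 2 * jap u ∨ jap (u + v) ≤ 2 * jap v := by
    have e1 := aux_jap_sq (u + v)
    have e2 := aux_jap_sq u
    have e3 := aux_jap_sq v
    have hn := norm_add_le u v
    have hn0 := norm_nonneg (u + v)
    have hn1 := norm_nonneg u
    have hn2 := norm_nonneg v
    rcases le_total ‖u‖ ‖v‖ with h | h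
    · right
      refine le_of_sq_le_sq ?_ (by have := aux_jap_pos v; positivity)
      rw [mul_pow, e1, e3]
      nlinarith
    · left
      refine le_of_sq_le_sq ?_ (by have := aux_jap_pos u; positivity)
      rw [mul_pow, e1, e2]
      nlinarith
  rcases hmax with h | h
  · have := key u s hs0 hs h
    calc _ ≤ ((4 : ℝ) ^ (m + 1) * jap (u + v) ^ (-(2 * s))) * jap v ^ (-(2 * t)) := by gcongr
      _ = (4 : ℝ) ^ (m + 1) * (jap v ^ (-(2 * t)) * jap (u + v) ^ (-(2 * s)) + 0) := by ring
      _ ≤ _ := by gcongr; positivity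
  · have := key v t ht0 ht h
    calc _ ≤ jap u ^ (-(2 * s)) * ((4 : ℝ) ^ (m + 1) * jap (u + v) ^ (-(2 * t))) := by gcongr
      _ = (4 : ℝ) ^ (m + 1) * (0 + jap u ^ (-(2 * s)) * jap (u + v) ^ (-(2 * t))) := by ring
      _ ≤ _ := by gcongr; positivity

lemma aux_fubini {E : Type*} [MeasureSpace E] [SigmaFinite (volume : Measure E)] (k : ℕ)
    (f : (Fin (k+1) → E) → ENNReal) (hf : Measurable f) :
    ∫⁻ y, f y = ∫⁻ z : Fin k → E, ∫⁻ x : E, f (Fin.cons x z : Fin (k+1) → E) := by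
  rw [← (volume_preserving_piFinSuccAbove (fun _ : Fin (k+1) => E) 0).symm.lintegral_comp_emb
      (MeasurableEquiv.measurableEmbedding _), Measure.volume_eq_prod]
  rw [lintegral_prod_symm']
  · refine lintegral_congr fun z => lintegral_congr fun x => ?_
    simp [MeasurableEquiv.piFinSuccAbove]
    rfl
  · exact hf.comp (MeasurableEquiv.measurable _)

section auxsec
variable {E : Type*} [NormedAddCommGroup E]

/-- the extended sequence -/
noncomputable def auxE (k : ℕ) (ξ : E) (y : Fin (k+1) → E) (j : ℕ) : E :=
  if h : j < k + 1 then y ⟨j, h⟩ else ξ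

noncomputable def auxP (k : ℕ) (ξ : E) (s : ℕ → ℝ) (y : Fin (k+1) → E) : ℝ :=
  ∏ j ∈ Finset.Ico 1 (k+2), jap (auxE k ξ y j - auxE k ξ y (j - 1)) ^ (-(s j))

noncomputable def auxG (k : ℕ) (γ : ℝ) (ξ : E) (s : ℕ → ℝ) (y : Fin (k+1) → E) : ℝ :=
  (∏ j : Fin (k+1), hfun γ ‖y j‖ ‖ξ‖) ^ 2 * (jap (y 0 + ξ) ^ (-(s 0)) * auxP k ξ s y) ^ 2

lemma auxG_nonneg (k : ℕ) (γ : ℝ) (ξ : E) (s : ℕ → ℝ) (y : Fin (k+1) → E) :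
    0 ≤ auxG k γ ξ s y := by unfold auxG; positivity

lemma auxE_cont (k : ℕ) (ξ : E) (j : ℕ) : Continuous fun y => auxE k ξ y j := by
  unfold auxE
  split_ifs <;> fun_prop

lemma auxG_cont (k : ℕ) (γ : ℝ) (hγ : 0 < γ) (ξ : E) (s : ℕ → ℝ) :
    Continuous (auxG k γ ξ s) := by
  unfold auxG auxP
  refine Continuous.mul (Continuous.pow ?_ 2) (Continuous.pow (Continuous.mul ?_ ?_) 2)
  · exact continuous_finsetProd _ fun j _ => aux_hfun_cont _ _ hγ _ (by fun_prop)
  · exact aux_japr_cont _ _ (by fun_prop)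
  · exact continuous_finsetProd _ fun j _ =>
      aux_japr_cont _ _ ((auxE_cont k ξ j).sub (auxE_cont k ξ (j-1)))

lemma auxE_cons_zero (k : ℕ) (ξ x : E) (z : Fin (k+1) → E) :
    auxE (k+1) ξ (Fin.cons x z : Fin (k+2) → E) 0 = x := by
  simp [auxE]

lemma auxE_zero (k : ℕ) (ξ : E) (z : Fin (k+1) → E) : auxE k ξ z 0 = z 0 := by
  simp [auxE]

lemma auxE_cons_succ (k : ℕ) (ξ x : E) (z : Fin (k+1) → E) (j : ℕ) :
    auxE (k+1) ξ (Fin.cons x z : Fin (k+2) → E) (j+1) = auxE k ξ z j := by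
  unfold auxE
  by_cases h : j < k + 1
  · rw [dif_pos h, dif_pos (by omega)]
    exact Fin.cons_succ (α := fun _ => E) x z ⟨j, h⟩
  · rw [dif_neg h, dif_neg (by omega)]

lemma auxP_cons (k : ℕ) (ξ x : E) (s : ℕ → ℝ) (z : Fin (k+1) → E) :
    auxP (k+1) ξ s (Fin.cons x z : Fin (k+2) → E) =
      jap (z 0 - x) ^ (-(s 1)) * auxP k ξ (fun j => s (j+1)) z := by
  unfold auxP
  rw [Finset.prod_eq_prod_Ico_succ_bot (by omega)]
  congr 1
  · rw [show k + 1 + 2 = (k + 2) + 1 by ring, ← Finset.prod_Ico_add' _ 1 (k+2) 1]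
    refine Finset.prod_congr rfl fun j hj => ?_
    obtain ⟨i, rfl⟩ : ∃ i, j = i + 1 := ⟨j - 1, by have := (Finset.mem_Ico.1 hj).1; omega⟩
    rw [auxE_cons_succ, Nat.add_sub_cancel, Nat.add_sub_cancel, auxE_cons_succ]

lemma auxG_cons_le (m k : ℕ) (γ : ℝ) (ξ : E) (s : ℕ → ℝ) (h0 : 0 ≤ s 0) (h0' : s 0 ≤ m + 1)
    (h1 : 0 ≤ s 1) (h1' : s 1 ≤ m + 1) (x : E) (z : Fin (k+1) → E) :
    auxG (k+1) γ ξ s (Fin.cons x z : Fin (k+2) → E) ≤ (4:ℝ) ^ (m+1) *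
      ((hfun γ ‖x‖ ‖ξ‖ ^ 2 * jap (x - (-ξ)) ^ (-(2 * s 0))) * auxG k γ ξ (fun j => s (j+1)) z +
       (hfun γ ‖x‖ ‖ξ‖ ^ 2 * jap (x - z 0) ^ (-(2 * s 1))) *
        auxG k γ ξ (fun j => if j = 0 then s 0 else s (j+1)) z) := by
  have hP : auxP k ξ (fun j => if j = 0 then s 0 else s (j+1)) z =
      auxP k ξ (fun j => s (j+1)) z := by
    unfold auxP
    refine Finset.prod_congr rfl fun j hj => ?_
    have := (Finset.mem_Ico.1 hj).1
    have h' : j ≠ 0 := by omega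
    simp [h']
  have hsq : ∀ (a : E) (p : ℝ), jap a ^ (-(2 * p)) = (jap a ^ (-p)) ^ 2 := by
    intro a p
    rw [← Real.rpow_mul_natCast (aux_jap_pos a).le]
    congr 1; push_cast; ring
  have hsp := aux_split m (s 0) (s 1) h0 h0' h1 h1' (x + ξ) (z 0 - x)
  have e1 : x + ξ + (z 0 - x) = z 0 + ξ := by abel
  have e2 : jap (x - z 0) = jap (z 0 - x) := by unfold jap; rw [norm_sub_rev]
  rw [e1] at hsp
  unfold auxG
  rw [hP, auxP_cons, Fin.prod_univ_succ, sub_neg_eq_add, e2]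
  simp only [Fin.cons_zero, Fin.cons_succ, if_true, zero_add]
  simp only [hsq] at hsp ⊢
  set W := ∏ j : Fin (k+1), hfun γ ‖z j‖ ‖ξ‖
  set P := auxP k ξ (fun j => s (j+1)) z
  set h := hfun γ ‖x‖ ‖ξ‖
  have hn : 0 ≤ h ^ 2 * W ^ 2 * P ^ 2 := by positivity
  have := mul_le_mul_of_nonneg_left hsp hn
  calc _ = h ^ 2 * W ^ 2 * P ^ 2 * ((jap (x + ξ) ^ (-s 0)) ^ 2 * (jap (z 0 - x) ^ (-s 1)) ^ 2) := by ring
    _ ≤ _ := this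
    _ = _ := by ring

end auxsec

noncomputable def auxL (n k : ℕ) (γ : ℝ) (ξ : EuclideanSpace ℝ (Fin n)) (s : ℕ → ℝ) : ENNReal :=
  ∫⁻ y : Fin (k+1) → EuclideanSpace ℝ (Fin n), ENNReal.ofReal (auxG k γ ξ s y)

lemma aux_T_eq (n k : ℕ) (γ : ℝ) (hγ : 0 < γ) (ξ : EuclideanSpace ℝ (Fin n)) (s : ℕ → ℝ) :
    Tfun n (k+2) γ ξ s = (auxL n k γ ξ s).toReal := by
  have : Tfun n (k+2) γ ξ s = ∫ y : Fin (k+1) → EuclideanSpace ℝ (Fin n), auxG k γ ξ s y := by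
    unfold Tfun
    change (∫ y : Fin (k+1) → EuclideanSpace ℝ (Fin n), _) = _
    congr 1
    funext y
    unfold auxG Mfun auxP
    simp [auxE]
  rw [this, auxL, integral_eq_lintegral_of_nonneg_ae]
  · exact Filter.Eventually.of_forall (auxG_nonneg k γ ξ s)
  · exact (auxG_cont k γ hγ ξ s).aestronglyMeasurable

lemma aux_step (m : ℕ) (ε : ℝ) (C : ℝ) (hC : 0 ≤ C) (hε : 0 < ε) 
    (key : ∀ s : ℝ, (m : ℝ) ≤ s → s ≤ m + 1 - ε → ∀ γ : ℝ, 0 < γ →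
      ∀ ξ z : EuclideanSpace ℝ (Fin (2 * m + 3)),
      ∫⁻ x : EuclideanSpace ℝ (Fin (2 * m + 3)),
        ENNReal.ofReal (hfun γ ‖x‖ ‖ξ‖ ^ 2 * jap (x - z) ^ (-(2 * s))) ≤
      ENNReal.ofReal (C * γ⁻¹ * jap ξ ^ (2 * (m : ℝ) - 2 * s)))
    (k : ℕ) (s : ℕ → ℝ) (h0 : (m : ℝ) ≤ s 0) (h0' : s 0 ≤ m + 1 - ε)
    (h1 : (m : ℝ) ≤ s 1) (h1' : s 1 ≤ m + 1 - ε) (γ : ℝ) (hγ : 0 < γ)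
    (ξ : EuclideanSpace ℝ (Fin (2 * m + 3))) :
    auxL (2*m+3) (k+1) γ ξ s ≤
      ENNReal.ofReal ((4:ℝ) ^ (m+1) * C * γ⁻¹ * jap ξ ^ (2 * (m : ℝ) - 2 * s 0)) *
        auxL (2*m+3) k γ ξ (fun j => s (j+1)) +
      ENNReal.ofReal ((4:ℝ) ^ (m+1) * C * γ⁻¹ * jap ξ ^ (2 * (m : ℝ) - 2 * s 1)) *
        auxL (2*m+3) k γ ξ (fun j => if j = 0 then s 0 else s (j+1)) := by
  have hm0 : (0:ℝ) ≤ m := by positivity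
  set G1 := auxG k γ ξ (fun j => s (j+1)) with hG1
  set G2 := auxG k γ ξ (fun j => if j = 0 then s 0 else s (j+1)) with hG2
  have hG1c : Continuous G1 := auxG_cont _ _ hγ _ _
  have hG2c : Continuous G2 := auxG_cont _ _ hγ _ _
  have hG1n : ∀ z, 0 ≤ G1 z := auxG_nonneg _ _ _ _
  have hG2n : ∀ z, 0 ≤ G2 z := auxG_nonneg _ _ _ _
  have hconv : auxL (2*m+3) (k+1) γ ξ s =
      ∫⁻ z : Fin (k+1) → EuclideanSpace ℝ (Fin (2*m+3)), ∫⁻ x : EuclideanSpace ℝ (Fin (2*m+3)),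
        ENNReal.ofReal (auxG (k+1) γ ξ s (Fin.cons x z : Fin (k+2) → _)) := by
    unfold auxL
    exact aux_fubini (k+1) _ (auxG_cont (k+1) γ hγ ξ s).measurable.ennreal_ofReal
  have hinner : ∀ z : Fin (k+1) → EuclideanSpace ℝ (Fin (2*m+3)),
      ∫⁻ x : EuclideanSpace ℝ (Fin (2*m+3)),
        ENNReal.ofReal (auxG (k+1) γ ξ s (Fin.cons x z : Fin (k+2) → _)) ≤
      ENNReal.ofReal ((4:ℝ) ^ (m+1) * C * γ⁻¹ * jap ξ ^ (2 * (m : ℝ) - 2 * s 0)) *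
        ENNReal.ofReal (G1 z) +
      ENNReal.ofReal ((4:ℝ) ^ (m+1) * C * γ⁻¹ * jap ξ ^ (2 * (m : ℝ) - 2 * s 1)) *
        ENNReal.ofReal (G2 z) := by
    intro z
    let q : ℝ → EuclideanSpace ℝ (Fin (2*m+3)) → EuclideanSpace ℝ (Fin (2*m+3)) → ENNReal :=
      fun p w x => ENNReal.ofReal (hfun γ ‖x‖ ‖ξ‖ ^ 2 * jap (x - w) ^ (-(2 * p)))
    have hqm : ∀ p w, Measurable (q p w) := fun p w =>
      (((aux_hfun_cont γ ‖ξ‖ hγ _ continuous_norm).pow 2).mul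
        (aux_japr_cont _ _ (by fun_prop))).measurable.ennreal_ofReal
    calc _ ≤ ∫⁻ x : EuclideanSpace ℝ (Fin (2*m+3)), ENNReal.ofReal ((4:ℝ)^(m+1)) *
          (q (s 0) (-ξ) x * ENNReal.ofReal (G1 z) + q (s 1) (z 0) x * ENNReal.ofReal (G2 z)) := by
          refine lintegral_mono fun x => ?_
          have hJ1 := Real.rpow_pos_of_pos (aux_jap_pos (x - (-ξ))) (-(2 * s 0))
          have hJ2 := Real.rpow_pos_of_pos (aux_jap_pos (x - z 0)) (-(2 * s 1))
          have := auxG_cons_le m k γ ξ s (by linarith) (by linarith) (by linarith) (by linarith) x z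
          refine (ENNReal.ofReal_le_ofReal this).trans (le_of_eq ?_)
          rw [ENNReal.ofReal_mul (by positivity),
            ENNReal.ofReal_add (mul_nonneg (by positivity) (hG1n z))
              (mul_nonneg (by positivity) (hG2n z)),
            ENNReal.ofReal_mul (by positivity), ENNReal.ofReal_mul (p := _ * _) (by positivity)]
      _ = ENNReal.ofReal ((4:ℝ)^(m+1)) * ((∫⁻ x, q (s 0) (-ξ) x) * ENNReal.ofReal (G1 z) +
            (∫⁻ x, q (s 1) (z 0) x) * ENNReal.ofReal (G2 z)) := by
          rw [lintegral_const_mul, lintegral_add_left, lintegral_mul_const _ (hqm _ _),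
            lintegral_mul_const _ (hqm _ _)]
          · exact (hqm _ _).mul_const _
          · exact ((hqm _ _).mul_const _).add ((hqm _ _).mul_const _)
      _ ≤ ENNReal.ofReal ((4:ℝ)^(m+1)) * (ENNReal.ofReal (C * γ⁻¹ * jap ξ ^ (2 * (m : ℝ) - 2 * s 0)) *
            ENNReal.ofReal (G1 z) +
            ENNReal.ofReal (C * γ⁻¹ * jap ξ ^ (2 * (m : ℝ) - 2 * s 1)) * ENNReal.ofReal (G2 z)) := by
          gcongr
          · exact key _ h0 h0' γ hγ ξ _
          · exact key _ h1 h1' γ hγ ξ _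
      _ = _ := by
          have e : ∀ J : ℝ, ENNReal.ofReal ((4:ℝ) ^ (m+1) * C * γ⁻¹ * J) =
              ENNReal.ofReal ((4:ℝ) ^ (m+1)) * ENNReal.ofReal (C * γ⁻¹ * J) := by
            intro J
            rw [← ENNReal.ofReal_mul (by positivity)]
            congr 1; ring
          rw [e, e]; ring
  rw [hconv]
  refine (lintegral_mono hinner).trans (le_of_eq ?_)
  rw [lintegral_add_left, lintegral_const_mul, lintegral_const_mul]
  · rfl
  · exact hG2c.measurable.ennreal_ofReal
  · exact hG1c.measurable.ennreal_ofReal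
  · exact hG1c.measurable.ennreal_ofReal.const_mul _

lemma aux_fin (m : ℕ) (ε : ℝ) (C : ℝ) (hC : 0 ≤ C) (hε : 0 < ε) 
    (key : ∀ s : ℝ, (m : ℝ) ≤ s → s ≤ m + 1 - ε → ∀ γ : ℝ, 0 < γ →
      ∀ ξ z : EuclideanSpace ℝ (Fin (2 * m + 3)),
      ∫⁻ x : EuclideanSpace ℝ (Fin (2 * m + 3)),
        ENNReal.ofReal (hfun γ ‖x‖ ‖ξ‖ ^ 2 * jap (x - z) ^ (-(2 * s))) ≤
      ENNReal.ofReal (C * γ⁻¹ * jap ξ ^ (2 * (m : ℝ) - 2 * s)))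
    (k : ℕ) (γ : ℝ) (hγ : 0 < γ) (ξ : EuclideanSpace ℝ (Fin (2 * m + 3))) :
    ∀ (s : ℕ → ℝ), (∀ j, j < k + 2 → (m : ℝ) ≤ s j ∧ s j ≤ (m : ℝ) + 1 - ε) → 
    auxL (2*m+3) k γ ξ s < ⊤ := by
  have hm0 : (0:ℝ) ≤ m := by positivity
  induction k with
  | zero =>
    intro s hs
    have h1 := hs 1 (by norm_num)
    have h0 := hs 0 (by norm_num)
    refine lt_of_le_of_lt ?_ (lt_of_le_of_lt (key (s 1) h1.1 h1.2 γ hγ ξ ξ) ENNReal.ofReal_lt_top)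
    rw [← (volume_preserving_funUnique (Fin 1) (EuclideanSpace ℝ (Fin (2*m+3)))).lintegral_comp_emb
      (MeasurableEquiv.measurableEmbedding _)]
    refine lintegral_mono fun y => ENNReal.ofReal_le_ofReal ?_
    have hA : jap (y 0 + ξ) ^ (-(s 0)) ≤ 1 :=
      Real.rpow_le_one_of_one_le_of_nonpos (aux_jap_one_le _) (by linarith)
    have hA0 := Real.rpow_pos_of_pos (aux_jap_pos (y 0 + ξ)) (-(s 0))
    have hB0 := Real.rpow_pos_of_pos (aux_jap_pos (y 0 - ξ)) (-(s 1))
    have e2 : jap (ξ - y 0) = jap (y 0 - ξ) := by unfold jap; rw [norm_sub_rev]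
    have e3 : jap (y 0 - ξ) ^ (-(2 * s 1)) = (jap (y 0 - ξ) ^ (-(s 1))) ^ 2 := by
      rw [← Real.rpow_mul_natCast (aux_jap_pos _).le]
      congr 1; push_cast; ring
    have e4 : (MeasurableEquiv.funUnique (Fin 1) (EuclideanSpace ℝ (Fin (2*m+3)))) y = y 0 := rfl
    rw [e4, e3]
    have e5 : auxG 0 γ ξ s y = hfun γ ‖y 0‖ ‖ξ‖ ^ 2 *
      (jap (y 0 + ξ) ^ (-(s 0)) * jap (y 0 - ξ) ^ (-(s 1))) ^ 2 := by
      unfold auxG auxP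
      simp [auxE, e2]
    rw [e5]
    gcongr
    nlinarith
  | succ k ih =>
    intro s hs
    have h1 := hs 1 (by omega)
    have h0 := hs 0 (by omega)
    refine lt_of_le_of_lt (aux_step m ε C hC hε key k s h0.1 h0.2 h1.1 h1.2 γ hγ ξ) ?_
    refine ENNReal.add_lt_top.2 ⟨ENNReal.mul_lt_top ENNReal.ofReal_lt_top (ih _ ?_),
      ENNReal.mul_lt_top ENNReal.ofReal_lt_top (ih _ ?_)⟩
    · intro j hj
      exact hs _ (by omega)
    · intro j hj
      split_ifs
      · exact h0
      · exact hs _ (by omega)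

theorem stmt_17 (n m : ℕ) (hn : n = 2 * m + 3) (ε : ℝ) (hε : 0 < ε) (hε1 : ε < 1) :
    ∃ C : ℝ, ∀ N : ℕ, 3 ≤ N → ∀ s : ℕ → ℝ,
      (∀ j, j < N → (m : ℝ) ≤ s j ∧ s j ≤ (m : ℝ) + 1 - ε) →
      ∀ γ : ℝ, 0 < γ → ∀ ξ : EuclideanSpace ℝ (Fin n),
        Tfun n N γ ξ s ≤
          (C / 2) * γ⁻¹ * jap ξ ^ (2 * (m : ℝ) - 2 * s 0) *
              Tfun n (N - 1) γ ξ (fun j => s (j + 1)) +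
          (C / 2) * γ⁻¹ * jap ξ ^ (2 * (m : ℝ) - 2 * s 1) *
              Tfun n (N - 1) γ ξ (fun j => if j = 0 then s 0 else s (j + 1)) := by
  subst hn
  obtain ⟨C, hC, key⟩ := aux_key m ε hε hε1
  refine ⟨2 * ((4:ℝ) ^ (m+1) * C), ?_⟩
  intro N hN s hs γ hγ ξ
  obtain ⟨k, rfl⟩ : ∃ k, N = k + 3 := ⟨N - 3, by omega⟩
  have h1 := hs 1 (by omega)
  have h0 := hs 0 (by omega)
  have hstep := aux_step m ε C hC hε key k s h0.1 h0.2 h1.1 h1.2 γ hγ ξ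
  have hf1 := aux_fin m ε C hC hε key k γ hγ ξ (fun j => s (j+1)) (fun j hj => hs _ (by omega))
  have hf2 := aux_fin m ε C hC hε key k γ hγ ξ (fun j => if j = 0 then s 0 else s (j+1)) (by
    intro j hj
    split_ifs
    · exact h0
    · exact hs _ (by omega))
  rw [show k + 3 - 1 = k + 2 by omega, aux_T_eq _ k γ hγ, aux_T_eq _ k γ hγ,
    show k + 3 = (k + 1) + 2 by ring, aux_T_eq _ (k+1) γ hγ]
  have hJ0 := Real.rpow_pos_of_pos (aux_jap_pos ξ) (2 * (m : ℝ) - 2 * s 0)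
  have hJ1 := Real.rpow_pos_of_pos (aux_jap_pos ξ) (2 * (m : ℝ) - 2 * s 1)
  have hfa := ENNReal.mul_lt_top (ENNReal.ofReal_lt_top
    (r := (4:ℝ) ^ (m+1) * C * γ⁻¹ * jap ξ ^ (2 * (m : ℝ) - 2 * s 0))) hf1
  have hfb := ENNReal.mul_lt_top (ENNReal.ofReal_lt_top
    (r := (4:ℝ) ^ (m+1) * C * γ⁻¹ * jap ξ ^ (2 * (m : ℝ) - 2 * s 1))) hf2
  have h := ENNReal.toReal_mono (ENNReal.add_lt_top.2 ⟨hfa, hfb⟩).ne hstep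
  rw [ENNReal.toReal_add hfa.ne hfb.ne, ENNReal.toReal_mul, ENNReal.toReal_mul,
    ENNReal.toReal_ofReal (by positivity), ENNReal.toReal_ofReal (by positivity)] at h
  rw [mul_div_cancel_left₀ _ (two_ne_zero)]
  exact h
end

section
/- Let n ≥ 3 be an odd integer, set m = (n−3)/2, and let 0 < ε < 1. For real numbers s₁, …, s_N with s_j ≥ m for each j, set a_j = min(s_j − m, 1 − ε). Then there is a constant C = C(n, ε) such that for every N ≥ 2, every γ > 0 and every ξ ∈ ℝⁿ, T_{N,γ}(ξ; s₁, …, s_N) ≤ C^{N-1} N^{2 min_j(s_j − a_j − m)} γ^{-(N-1)} (1 + 4|ξ|²)^{−min_j(s_j − a_j) − Σ_{j=1}^N a_j}. -/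
open MeasureTheory Finset

/-- Polar coordinates for a radial function times a homogeneous function. -/
theorem polar_lintegral {E : Type*} [NormedAddCommGroup E] [NormedSpace ℝ E]
    [MeasurableSpace E] [BorelSpace E] [FiniteDimensional ℝ E] [Nontrivial E]
    (μ : Measure E) [μ.IsAddHaarMeasure]
    (f : ℝ → ENNReal) (g : E → ENNReal) (hf : Measurable f) (hgm : Measurable g)
    (hg : ∀ r : ℝ, 0 < r → ∀ x, g (r • x) = g x) :
    ∫⁻ x, f ‖x‖ * g x ∂μ = (∫⁻ w : Metric.sphere (0 : E) 1, g w ∂μ.toSphere) *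
      ∫⁻ r in Set.Ioi (0 : ℝ), ENNReal.ofReal (r ^ (Module.finrank ℝ E - 1)) * f r := by
  calc ∫⁻ x, f ‖x‖ * g x ∂μ
      = ∫⁻ x : ({(0)}ᶜ : Set E), f ‖x.1‖ * g x.1 ∂(μ.comap (↑)) := by
        rw [lintegral_subtype_comap (measurableSet_singleton _).compl fun x ↦ f ‖x‖ * g x,
          MeasureTheory.restrict_compl_singleton]
    _ = ∫⁻ z, g z.1 * f z.2 ∂μ.toSphere.prod (.volumeIoiPow (Module.finrank ℝ E - 1)) := by
        rw [← μ.measurePreserving_homeomorphUnitSphereProd.lintegral_comp]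
        · refine lintegral_congr fun x => ?_
          rw [mul_comm]
          have hx : 0 < ‖x.1‖ := norm_pos_iff.mpr x.2
          simp only [homeomorphUnitSphereProd_apply_snd_coe,
            homeomorphUnitSphereProd_apply_fst_coe]
          rw [hg _ (inv_pos.mpr hx)]
        · fun_prop
    _ = (∫⁻ w : Metric.sphere (0 : E) 1, g w ∂μ.toSphere) *
          ∫⁻ r : Set.Ioi (0 : ℝ), f r ∂(.volumeIoiPow (Module.finrank ℝ E - 1)) := by
        exact lintegral_prod_mul (f := fun w : Metric.sphere (0 : E) 1 => g w)
          (g := fun r : Set.Ioi (0 : ℝ) => f r) (by fun_prop) (by fun_prop)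
    _ = _ := by
        congr 1
        rw [Measure.volumeIoiPow, lintegral_withDensity_eq_lintegral_mul]
        · simp only [Pi.mul_apply]
          rw [lintegral_subtype_comap measurableSet_Ioi
            fun a : ℝ ↦ ENNReal.ofReal (a ^ (Module.finrank ℝ E - 1)) * f a]
        · fun_prop
        · fun_prop

theorem lintegral_gamma (γ k : ℝ) (hγ : 0 < γ) :
    ∫⁻ r : ℝ, ENNReal.ofReal (((γ + |r - k|)⁻¹) ^ 2) ≤ ENNReal.ofReal (Real.pi / γ) := by
  have h1 : ∀ r : ℝ, ((γ + |r - k|)⁻¹) ^ 2 ≤ γ⁻¹ ^ 2 * (1 + ((r - k) / γ) ^ 2)⁻¹ := by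
    intro r
    rw [inv_pow, inv_pow, ← mul_inv]
    apply inv_anti₀ (by positivity)
    have : γ ^ 2 * (1 + ((r - k) / γ) ^ 2) = γ ^ 2 + (r - k) ^ 2 := by field_simp
    rw [this, ← sq_abs (r - k)]
    nlinarith [abs_nonneg (r - k)]
  have hi : Integrable (fun r : ℝ => γ⁻¹ ^ 2 * (1 + ((r - k) / γ) ^ 2)⁻¹) := by
    apply Integrable.const_mul
    have := (integrable_inv_one_add_sq.comp_div hγ.ne').comp_sub_right k
    exact this
  calc _ ≤ ∫⁻ r : ℝ, ENNReal.ofReal (γ⁻¹ ^ 2 * (1 + ((r - k) / γ) ^ 2)⁻¹) :=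
        lintegral_mono fun r => ENNReal.ofReal_le_ofReal (h1 r)
    _ = ENNReal.ofReal (∫ r : ℝ, γ⁻¹ ^ 2 * (1 + ((r - k) / γ) ^ 2)⁻¹) := by
        rw [ofReal_integral_eq_lintegral_ofReal hi]
        exact Filter.Eventually.of_forall fun r => by positivity
    _ = _ := by
        congr 1
        rw [integral_const_mul,
          integral_sub_right_eq_self (fun r : ℝ => (1 + (r / γ) ^ 2)⁻¹) k,
          Measure.integral_comp_div (fun r : ℝ => (1 + r ^ 2)⁻¹) γ, integral_univ_inv_one_add_sq,
          abs_of_pos hγ, smul_eq_mul]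
        field_simp

/-- size of the tail of a vector -/
noncomputable def tau {d : ℕ} (x : EuclideanSpace ℝ (Fin (d + 1))) : ℝ :=
  ‖fun i : Fin d => x i.succ‖

theorem tau_meas {d : ℕ} : Measurable (tau : EuclideanSpace ℝ (Fin (d + 1)) → ℝ) := by
  unfold tau
  fun_prop

theorem tau_le_norm {d : ℕ} (x : EuclideanSpace ℝ (Fin (d + 1))) (t : ℝ) :
    tau x ≤ ‖x - EuclideanSpace.single 0 t‖ := by
  unfold tau
  rw [pi_norm_le_iff_of_nonneg (norm_nonneg _)]
  intro i
  have := PiLp.norm_apply_le (x - EuclideanSpace.single 0 t) i.succ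
  simpa using this

theorem tau_le_norm' {d : ℕ} (x : EuclideanSpace ℝ (Fin (d + 1))) : tau x ≤ ‖x‖ := by
  unfold tau
  rw [pi_norm_le_iff_of_nonneg (norm_nonneg _)]
  exact fun i => PiLp.norm_apply_le x i.succ

theorem tau_smul {d : ℕ} (x : EuclideanSpace ℝ (Fin (d + 1))) (r : ℝ) (hr : 0 < r) :
    tau (r • x) = r * tau x := by
  unfold tau
  have : (fun i : Fin d => (r • x) i.succ) = r • (fun i : Fin d => x i.succ) := by
    ext i; simp
  rw [this, norm_smul, Real.norm_of_nonneg hr.le]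

/-- local integrability of a singular power -/
theorem sing_ball (d : ℕ) (hd : 0 < d) (q : ℝ) (hq : q < d) :
    ∫⁻ y in Metric.ball (0 : Fin d → ℝ) 1, (ENNReal.ofReal ‖y‖) ^ (-q) < ⊤ := by
  have : Nonempty (Fin d) := ⟨⟨0, hd⟩⟩
  have hI : IntegrableOn (fun y : Fin d → ℝ => ‖y‖ ^ (-q)) (Metric.ball 0 1) := by
    rw [integrableOn_fun_norm_addHaar volume (f := fun r => r ^ (-q))]
    have h2 : IntegrableOn (fun y : ℝ => y ^ ((d : ℝ) - 1 - q)) (Set.Ioo 0 1) := by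
      rw [intervalIntegral.integrableOn_Ioo_rpow_iff one_pos]
      linarith
    refine h2.congr_fun (fun y hy => ?_) measurableSet_Ioo
    simp only [Module.finrank_fintype_fun_eq_card, Fintype.card_fin, smul_eq_mul]
    rw [← Real.rpow_natCast, ← Real.rpow_add hy.1, Nat.cast_sub hd]
    congr 1
    push_cast; ring
  have h3 := hI.hasFiniteIntegral
  rw [hasFiniteIntegral_iff_ofReal (Filter.Eventually.of_forall fun y => by positivity)] at h3
  refine lt_of_le_of_lt (lintegral_mono_ae ?_) h3
  have : ∀ᵐ y : Fin d → ℝ, y ≠ 0 := by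
    simp [ae_iff]
  filter_upwards [ae_restrict_of_ae this] with y hy
  rw [ENNReal.ofReal_rpow_of_pos (norm_pos_iff.mpr hy)]

theorem sing_ball_euclid (d : ℕ) (hd : 0 < d) (q : ℝ) (hq : q < d) :
    ∫⁻ x in Metric.ball (0 : EuclideanSpace ℝ (Fin (d + 1))) 1, (ENNReal.ofReal (tau x)) ^ (-q)
      < ⊤ := by
  have hsub : ∀ x ∈ Metric.ball (0 : EuclideanSpace ℝ (Fin (d + 1))) 1,
      |x 0| < 1 ∧ tau x < 1 := by
    intro x hx
    have hx : ‖x‖ < 1 := by simpa using hx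
    refine ⟨lt_of_le_of_lt (PiLp.norm_apply_le x 0) hx, ?_⟩
    have := tau_le_norm' x
    linarith
  let G : ℝ × (Fin d → ℝ) → ENNReal := fun z =>
    (Set.indicator (Metric.ball (0 : ℝ) 1) (fun _ => 1) z.1) *
      (Set.indicator (Metric.ball (0 : Fin d → ℝ) 1) (fun y => (ENNReal.ofReal ‖y‖) ^ (-q)) z.2)
  have hm1 : Measurable (Set.indicator (Metric.ball (0 : ℝ) 1) (fun _ => (1 : ENNReal))) :=
    measurable_const.indicator measurableSet_ball
  have hm2 : Measurable (Set.indicator (Metric.ball (0 : Fin d → ℝ) 1)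
      (fun y => (ENNReal.ofReal ‖y‖) ^ (-q))) :=
    Measurable.indicator (by fun_prop) measurableSet_ball
  have hG : Measurable G := (hm1.comp measurable_fst).mul (hm2.comp measurable_snd)
  have hmp : MeasurePreserving (fun x : EuclideanSpace ℝ (Fin (d + 1)) =>
      MeasurableEquiv.piFinSuccAbove (fun _ => ℝ) 0 (WithLp.ofLp x)) :=
    (volume_preserving_piFinSuccAbove (fun _ : Fin (d + 1) => ℝ) 0).comp
      (PiLp.volume_preserving_ofLp (Fin (d + 1)))
  calc _ ≤ ∫⁻ x : EuclideanSpace ℝ (Fin (d + 1)),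
        G (MeasurableEquiv.piFinSuccAbove (fun _ => ℝ) 0 (WithLp.ofLp x)) := by
        rw [← lintegral_indicator measurableSet_ball]
        refine lintegral_mono fun x => ?_
        by_cases hx : x ∈ Metric.ball (0 : EuclideanSpace ℝ (Fin (d + 1))) 1
        · rw [Set.indicator_of_mem hx]
          obtain ⟨h1, h2⟩ := hsub x hx
          simp only [G]
          rw [Set.indicator_of_mem, Set.indicator_of_mem]
          · rw [one_mul]; rfl
          · rw [mem_ball_zero_iff]; exact h2
          · rw [mem_ball_zero_iff]; exact h1
        · rw [Set.indicator_of_notMem hx]; exact zero_le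
    _ = ∫⁻ z, G z := hmp.lintegral_comp hG
    _ = (∫⁻ t, Set.indicator (Metric.ball (0 : ℝ) 1) (fun _ => 1) t) *
        ∫⁻ y, (Set.indicator (Metric.ball (0 : Fin d → ℝ) 1)
          (fun y => (ENNReal.ofReal ‖y‖) ^ (-q)) y) :=
        lintegral_prod_mul hm1.aemeasurable hm2.aemeasurable
    _ < ⊤ := by
        rw [lintegral_indicator measurableSet_ball, lintegral_indicator measurableSet_ball]
        apply ENNReal.mul_lt_top _ (sing_ball d hd q hq)
        simp

/-- the homogeneous singular function -/
noncomputable def gq {d : ℕ} (q : ℝ) (x : EuclideanSpace ℝ (Fin (d + 1))) : ENNReal :=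
  (ENNReal.ofReal (tau x / ‖x‖)) ^ (-q)

theorem gq_meas {d : ℕ} (q : ℝ) : Measurable (gq (d := d) q) := by
  unfold gq
  have := tau_meas (d := d)
  fun_prop

theorem gq_hom {d : ℕ} (q : ℝ) (r : ℝ) (hr : 0 < r) (x : EuclideanSpace ℝ (Fin (d + 1))) :
    gq q (r • x) = gq q x := by
  unfold gq
  rw [tau_smul x r hr, norm_smul, Real.norm_of_nonneg hr.le, mul_div_mul_left _ _ hr.ne']

theorem sphere_fin (d : ℕ) (hd : 0 < d) (q : ℝ) (hq0 : 0 ≤ q) (hq : q < d) :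
    ∫⁻ w : Metric.sphere (0 : EuclideanSpace ℝ (Fin (d + 1))) 1, gq q w.1
      ∂(volume : Measure (EuclideanSpace ℝ (Fin (d + 1)))).toSphere < ⊤ := by
  have h := polar_lintegral (volume : Measure (EuclideanSpace ℝ (Fin (d + 1))))
    (Set.indicator (Set.Iio 1) (fun _ => 1)) (gq q)
    (measurable_const.indicator measurableSet_Iio) (gq_meas q) (gq_hom q)
  have h1 : ∫⁻ x : EuclideanSpace ℝ (Fin (d + 1)),
      Set.indicator (Set.Iio 1) (fun _ => 1) ‖x‖ * gq q x < ⊤ := by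
    refine lt_of_le_of_lt ?_ (sing_ball_euclid d hd q hq)
    rw [← lintegral_indicator measurableSet_ball]
    refine lintegral_mono fun x => ?_
    by_cases hx : ‖x‖ < 1
    · rw [Set.indicator_of_mem (by simpa using hx), Set.indicator_of_mem (by simpa using hx),
        one_mul]
      unfold gq
      rw [ENNReal.rpow_neg, ENNReal.rpow_neg, ENNReal.inv_le_inv]
      apply ENNReal.rpow_le_rpow _ hq0
      apply ENNReal.ofReal_le_ofReal
      have : 0 ≤ tau x := norm_nonneg _
      rcases (norm_nonneg x).eq_or_lt with h0 | h0
      · have := tau_le_norm' x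
        rw [← h0] at this
        simp [← h0]; linarith
      · rw [le_div_iff₀ h0]
        nlinarith
    · rw [Set.indicator_of_notMem (by simpa using hx)]; simp
  rw [h] at h1
  by_contra hcon
  rw [not_lt, top_le_iff] at hcon
  rw [hcon, ENNReal.top_mul] at h1
  · exact lt_irrefl _ h1
  · rw [← pos_iff_ne_zero]
    rw [setLIntegral_pos_iff]
    · have : Set.Ioo (0 : ℝ) 1 ⊆ (Function.support fun r : ℝ => ENNReal.ofReal (r ^
          (Module.finrank ℝ (EuclideanSpace ℝ (Fin (d + 1))) - 1)) *
          Set.indicator (Set.Iio 1) (fun _ => 1) r) ∩ Set.Ioi 0 := by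
        intro r hr
        refine ⟨?_, hr.1⟩
        rw [Function.mem_support, Set.indicator_of_mem (by exact hr.2), mul_one]
        simp only [ne_eq, ENNReal.ofReal_eq_zero, not_le]
        exact pow_pos hr.1 _
      refine lt_of_lt_of_le ?_ (measure_mono this)
      simp
    · have : Measurable (Set.indicator (Set.Iio (1 : ℝ)) (fun _ => (1 : ENNReal))) :=
        (measurable_const.indicator measurableSet_Iio)
      fun_prop

theorem radial_aux (r k a : ℝ) (hr : 0 < r) (hk : 0 ≤ k) (ha : 0 ≤ a) (ha1 : a ≤ 1) :
    r ^ 2 * (1 + r ^ 2) ^ (-a) ≤ (r + k) ^ 2 * (1 + k ^ 2) ^ (-a) := by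
  have hr1 : 0 < 1 + r ^ 2 := by positivity
  have hk1 : 0 < 1 + k ^ 2 := by positivity
  rcases le_total k r with h | h
  · have h1 : (1 + r ^ 2) ^ (-a) ≤ (1 + k ^ 2) ^ (-a) :=
      Real.rpow_le_rpow_of_nonpos hk1 (by nlinarith) (by linarith)
    have h2 : r ^ 2 ≤ (r + k) ^ 2 := by nlinarith
    exact mul_le_mul h1 h2 (by positivity) (by positivity) |> fun h => by
      simpa [mul_comm] using h
  · have h1 : ((1 + k ^ 2) / (1 + r ^ 2)) ^ a ≤ ((1 + k ^ 2) / (1 + r ^ 2)) ^ (1 : ℝ) := by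
      apply Real.rpow_le_rpow_of_exponent_le _ ha1
      rw [le_div_iff₀ hr1]; nlinarith
    rw [Real.rpow_one, Real.div_rpow hk1.le hr1.le] at h1
    rw [Real.rpow_neg hr1.le, Real.rpow_neg hk1.le, ← div_eq_mul_inv, ← div_eq_mul_inv,
      div_le_div_iff₀ (by positivity) (by positivity)]
    rw [div_le_div_iff₀ (by positivity) (by positivity)] at h1
    have h3 : r ^ 2 * (1 + k ^ 2) ≤ (r + k) ^ 2 * (1 + r ^ 2) := by
      nlinarith [mul_nonneg hr.le hk, mul_nonneg (mul_nonneg hr.le hk) (sq_nonneg r), sq_nonneg (r^2)]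
    have hA : 0 < (1 + r ^ 2) ^ a := by positivity
    have h4 : r ^ 2 * ((1 + k ^ 2) ^ a * (1 + r ^ 2)) ≤ (r + k) ^ 2 * (1 + r ^ 2) ^ a * (1 + r ^ 2) := by
      calc r ^ 2 * ((1 + k ^ 2) ^ a * (1 + r ^ 2)) ≤ r ^ 2 * ((1 + k ^ 2) * (1 + r ^ 2) ^ a) := by
            gcongr
        _ = (r ^ 2 * (1 + k ^ 2)) * (1 + r ^ 2) ^ a := by ring
        _ ≤ ((r + k) ^ 2 * (1 + r ^ 2)) * (1 + r ^ 2) ^ a := by gcongr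
        _ = _ := by ring
    nlinarith

theorem radial_bound (m : ℕ) (r k γ a : ℝ) (hr : 0 < r) (hk : 0 ≤ k) (hγ : 0 < γ) (ha : 0 ≤ a)
    (ha1 : a ≤ 1) :
    r ^ (2 * m + 2) * (hfun γ r k ^ 2 * (1 + r ^ 2) ^ (-((m : ℝ) + a))) ≤
      (1 + k ^ 2) ^ (-a) * ((γ + |r - k|)⁻¹) ^ 2 := by
  unfold hfun
  have hr1 : 0 < 1 + r ^ 2 := by positivity
  have hsplit : (1 + r ^ 2) ^ (-((m : ℝ) + a)) = ((1 + r ^ 2) ^ m)⁻¹ * (1 + r ^ 2) ^ (-a) := by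
    rw [neg_add, Real.rpow_add hr1, Real.rpow_neg hr1.le, Real.rpow_natCast]
  rw [hsplit, abs_of_pos (show 0 < r + k by linarith)]
  have h1 : (r ^ 2) ^ m * ((1 + r ^ 2) ^ m)⁻¹ ≤ 1 := by
    rw [← div_eq_mul_inv]
    apply div_le_one_of_le₀ _ (by positivity)
    gcongr; linarith
  have h2 := radial_aux r k a hr hk ha ha1
  have h3 : ((γ + (r + k))⁻¹) ^ 2 * (r + k) ^ 2 ≤ 1 := by
    rw [← mul_pow]
    apply pow_le_one₀ (by positivity)
    rw [inv_mul_le_iff₀ (by positivity)]; linarith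
  calc _ = ((γ + |r - k|)⁻¹) ^ 2 * (((γ + (r + k))⁻¹) ^ 2 * (((r ^ 2) ^ m * ((1 + r ^ 2) ^ m)⁻¹) *
          (r ^ 2 * (1 + r ^ 2) ^ (-a)))) := by ring
    _ ≤ ((γ + |r - k|)⁻¹) ^ 2 * (((γ + (r + k))⁻¹) ^ 2 * (1 *
          ((r + k) ^ 2 * (1 + k ^ 2) ^ (-a)))) := by gcongr
    _ = ((γ + |r - k|)⁻¹) ^ 2 * (1 + k ^ 2) ^ (-a) * (((γ + (r + k))⁻¹) ^ 2 * (r + k) ^ 2) := by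
        ring
    _ ≤ ((γ + |r - k|)⁻¹) ^ 2 * (1 + k ^ 2) ^ (-a) * 1 := by gcongr
    _ = _ := by ring

theorem ang_bound {d : ℕ} (p q : ℝ) (hp : 0 ≤ p) (hq : 0 < q) (hpq : 2 * p ≤ q)
    (x : EuclideanSpace ℝ (Fin (d + 1))) (t : ℝ) :
    ENNReal.ofReal ((1 + ‖x - EuclideanSpace.single 0 t‖ ^ 2) ^ (-p)) ≤
      ENNReal.ofReal ((1 + ‖x‖ ^ 2) ^ (-p)) * gq q x := by
  unfold gq
  have htau := tau_le_norm x t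
  have htau' := tau_le_norm' x
  have ht0 : 0 ≤ tau x := norm_nonneg _
  set θ := tau x / ‖x‖ with hθ
  have hθ0 : 0 ≤ θ := by positivity
  have hθ1 : θ ≤ 1 := div_le_one_of_le₀ htau' (norm_nonneg _)
  rcases hθ0.eq_or_lt with h0 | h0
  · rw [← h0, ENNReal.ofReal_zero, ENNReal.zero_rpow_of_neg (by linarith), ENNReal.mul_top]
    · exact le_top
    · simp only [ne_eq, ENNReal.ofReal_eq_zero, not_le]; positivity
  · rw [ENNReal.ofReal_rpow_of_pos h0, ← ENNReal.ofReal_mul (by positivity)]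
    apply ENNReal.ofReal_le_ofReal
    have hx0 : ‖x‖ ≠ 0 := by
      intro h; rw [hθ, h, div_zero] at h0; exact lt_irrefl _ h0
    have e1 : tau x = θ * ‖x‖ := by rw [hθ]; field_simp
    have h1 : (1 + ‖x‖ ^ 2) * θ ^ 2 ≤ 1 + ‖x - EuclideanSpace.single 0 t‖ ^ 2 := by
      have : tau x ^ 2 ≤ ‖x - EuclideanSpace.single 0 t‖ ^ 2 := by gcongr
      rw [e1] at this
      nlinarith
    calc _ ≤ ((1 + ‖x‖ ^ 2) * θ ^ 2) ^ (-p) :=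
          Real.rpow_le_rpow_of_nonpos (by positivity) h1 (by linarith)
      _ = (1 + ‖x‖ ^ 2) ^ (-p) * θ ^ (-(2 * p)) := by
          rw [Real.mul_rpow (by positivity) (by positivity), ← Real.rpow_natCast θ 2,
            ← Real.rpow_mul h0.le]
          congr 2; push_cast; ring
      _ ≤ _ := by
          gcongr ?_ * ?_
          exact Real.rpow_le_rpow_of_exponent_ge h0 hθ1 (by linarith)

theorem rotate {F : Type*} [NormedAddCommGroup F] [InnerProductSpace ℝ F] [FiniteDimensional ℝ F]
    [MeasurableSpace F] [BorelSpace F] (G : ℝ → ℝ → ENNReal) (z w : F) (h : ‖z‖ = ‖w‖) :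
    ∫⁻ x : F, G ‖x‖ ‖x - z‖ = ∫⁻ x : F, G ‖x‖ ‖x - w‖ := by
  let ρ := Submodule.reflection (ℝ ∙ (z - w))ᗮ
  have hρ : ρ z = w := Submodule.reflection_sub h
  have := ρ.measurePreserving.lintegral_comp_emb ρ.toHomeomorph.measurableEmbedding
    (fun x => G ‖x‖ ‖x - w‖)
  rw [← this]
  refine lintegral_congr fun x => ?_
  rw [← hρ, ← map_sub, ρ.norm_map, ρ.norm_map]

theorem lemA (m : ℕ) (c : ℝ) (hc : 0 < c) (hc1 : c < 1) :
    ∃ K : ℝ, 0 ≤ K ∧ ∀ a : ℝ, 0 ≤ a → a ≤ c → ∀ k : ℝ, 0 ≤ k → ∀ γ : ℝ, 0 < γ →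
      ∀ z : EuclideanSpace ℝ (Fin (2 * m + 3)),
      ∫⁻ x : EuclideanSpace ℝ (Fin (2 * m + 3)),
        ENNReal.ofReal (hfun γ ‖x‖ k ^ 2 * (1 + ‖x - z‖ ^ 2) ^ (-((m : ℝ) + a))) ≤
      ENNReal.ofReal (K / γ * (1 + k ^ 2) ^ (-a)) := by
  have hS := sphere_fin (2 * m + 2) (by omega) (2 * (m + c)) (by positivity)
    (by push_cast; linarith)
  set S := ∫⁻ w : Metric.sphere (0 : EuclideanSpace ℝ (Fin (2 * m + 2 + 1))) 1,
    gq (2 * (m + c)) w.1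
      ∂(volume : Measure (EuclideanSpace ℝ (Fin (2 * m + 2 + 1)))).toSphere with hSdef
  refine ⟨S.toReal * Real.pi, by positivity, ?_⟩
  intro a ha hac k hk γ hγ z
  have hfm : Measurable (fun r : ℝ =>
      ENNReal.ofReal (hfun γ r k ^ 2 * (1 + r ^ 2) ^ (-((m : ℝ) + a)))) := by
    unfold hfun; fun_prop
  have hrot := rotate (fun r t => ENNReal.ofReal (hfun γ r k ^ 2 * (1 + t ^ 2) ^ (-((m : ℝ) + a))))
    z (EuclideanSpace.single (0 : Fin (2 * m + 2 + 1)) ‖z‖) (by simp)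
  rw [hrot]
  calc _ ≤ ∫⁻ x : EuclideanSpace ℝ (Fin (2 * m + 2 + 1)),
        ENNReal.ofReal (hfun γ ‖x‖ k ^ 2 * (1 + ‖x‖ ^ 2) ^ (-((m : ℝ) + a))) *
          gq (2 * (m + c)) x := by
        refine lintegral_mono fun x => ?_
        simp only
        rw [ENNReal.ofReal_mul (sq_nonneg _), ENNReal.ofReal_mul (sq_nonneg _), mul_assoc]
        gcongr
        exact ang_bound _ _ (by positivity) (by positivity) (by linarith) _ _
    _ = S * ∫⁻ r in Set.Ioi (0 : ℝ), ENNReal.ofReal (r ^ (2 * m + 2)) *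
          ENNReal.ofReal (hfun γ r k ^ 2 * (1 + r ^ 2) ^ (-((m : ℝ) + a))) := by
        rw [polar_lintegral volume (fun r : ℝ =>
          ENNReal.ofReal (hfun γ r k ^ 2 * (1 + r ^ 2) ^ (-((m : ℝ) + a)))) _ hfm
          (gq_meas _) (gq_hom _)]
        simp [hSdef]
    _ ≤ S * ∫⁻ r in Set.Ioi (0 : ℝ), ENNReal.ofReal ((1 + k ^ 2) ^ (-a)) *
          ENNReal.ofReal (((γ + |r - k|)⁻¹) ^ 2) := by
        refine mul_le_mul' le_rfl ?_
        apply setLIntegral_mono' measurableSet_Ioi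
        intro r hr
        rw [← ENNReal.ofReal_mul (pow_nonneg (le_of_lt hr) _), ← ENNReal.ofReal_mul (by positivity)]
        exact ENNReal.ofReal_le_ofReal (radial_bound m r k γ a hr hk hγ ha (by linarith))
    _ ≤ S * (ENNReal.ofReal ((1 + k ^ 2) ^ (-a)) * ENNReal.ofReal (Real.pi / γ)) := by
        refine mul_le_mul' le_rfl ?_
        rw [lintegral_const_mul _ (by fun_prop)]
        gcongr
        exact (setLIntegral_le_lintegral _ _).trans (lintegral_gamma γ k hγ)
    _ = _ := by
        rw [← ENNReal.ofReal_toReal hS.ne, ← ENNReal.ofReal_mul (by positivity),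
          ← ENNReal.ofReal_mul (by positivity), ENNReal.toReal_ofReal (by positivity)]
        congr 1
        ring

theorem split_aux (m : ℕ) (u v w p q : ℝ) (hu : 1 ≤ u) (hv : 1 ≤ v) (hw : 1 ≤ w)
    (h : w ≤ 4 * u ∨ w ≤ 4 * v) (hp : 0 ≤ p) (hq : 0 ≤ q) (hp1 : p ≤ (m : ℝ) + 1)
    (hq1 : q ≤ (m : ℝ) + 1) :
    u ^ (-p) * v ^ (-q) ≤
      (4 : ℝ) ^ ((m : ℝ) + 1) * (w ^ (-p) * v ^ (-q) + w ^ (-q) * u ^ (-p)) := by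
  have key : ∀ x y : ℝ, 1 ≤ x → 0 ≤ y → y ≤ (m : ℝ) + 1 → w ≤ 4 * x →
      x ^ (-y) ≤ (4 : ℝ) ^ ((m : ℝ) + 1) * w ^ (-y) := by
    intro x y hx hy hy1 hwx
    have h1 : x ^ (-y) ≤ (w / 4) ^ (-y) :=
      Real.rpow_le_rpow_of_nonpos (by positivity) (by linarith) (by linarith)
    rw [Real.div_rpow (by linarith) (by norm_num), Real.rpow_neg (by norm_num : (0:ℝ) ≤ 4),
      div_inv_eq_mul, mul_comm] at h1
    refine h1.trans ?_
    gcongr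
    norm_num
  have hu0 : 0 < u := by linarith
  have hv0 : 0 < v := by linarith
  have hw0 : 0 < w := by linarith
  rcases h with h | h
  · have := key u p hu hp hp1 h
    calc _ ≤ ((4 : ℝ) ^ ((m : ℝ) + 1) * w ^ (-p)) * v ^ (-q) := by gcongr
      _ ≤ _ := by
        rw [mul_assoc]
        gcongr
        have : 0 ≤ w ^ (-q) * u ^ (-p) := by positivity
        linarith
  · have := key v q hv hq hq1 h
    calc _ ≤ u ^ (-p) * ((4 : ℝ) ^ ((m : ℝ) + 1) * w ^ (-q)) := by gcongr
      _ = (4 : ℝ) ^ ((m : ℝ) + 1) * (w ^ (-q) * u ^ (-p)) := by ring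
      _ ≤ _ := by
        gcongr
        have : 0 ≤ w ^ (-p) * v ^ (-q) := by positivity
        linarith

theorem tri_aux {F : Type*} [NormedAddCommGroup F] (x y z : F) :
    1 + ‖z + y‖ ^ 2 ≤ 4 * (1 + ‖x + y‖ ^ 2) ∨ 1 + ‖z + y‖ ^ 2 ≤ 4 * (1 + ‖z - x‖ ^ 2) := by
  have h : ‖z + y‖ ≤ ‖x + y‖ + ‖z - x‖ := by
    have := norm_add_le (x + y) (z - x)
    rwa [show x + y + (z - x) = z + y by abel] at this
  have h0 := norm_nonneg (z + y)
  have h1 := norm_nonneg (x + y)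
  have h2 := norm_nonneg (z - x)
  rcases le_total ‖x + y‖ ‖z - x‖ with hh | hh
  · right; nlinarith
  · left; nlinarith

theorem lemB (m : ℕ) (c : ℝ) (hc : 0 < c) (hc1 : c < 1) :
    ∃ K : ℝ, 0 ≤ K ∧ ∀ a : ℝ, 0 ≤ a → a ≤ c → ∀ b : ℝ, 0 ≤ b → b ≤ c → ∀ γ : ℝ, 0 < γ →
      ∀ ξ z : EuclideanSpace ℝ (Fin (2 * m + 3)),
      ∫⁻ x : EuclideanSpace ℝ (Fin (2 * m + 3)),
        ENNReal.ofReal (hfun γ ‖x‖ ‖ξ‖ ^ 2 * ((1 + ‖x + ξ‖ ^ 2) ^ (-((m : ℝ) + a)) *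
          (1 + ‖z - x‖ ^ 2) ^ (-((m : ℝ) + b)))) ≤
      ENNReal.ofReal (K / γ * ((1 + ‖z + ξ‖ ^ 2) ^ (-((m : ℝ) + a)) * (1 + ‖ξ‖ ^ 2) ^ (-b) +
        (1 + ‖z + ξ‖ ^ 2) ^ (-((m : ℝ) + b)) * (1 + ‖ξ‖ ^ 2) ^ (-a))) := by
  obtain ⟨K, hK, hA⟩ := lemA m c hc hc1
  refine ⟨(4 : ℝ) ^ ((m : ℝ) + 1) * K, by positivity, ?_⟩
  intro a ha hac b hb hbc γ hγ ξ z
  have A1 := hA b hb hbc ‖ξ‖ (norm_nonneg _) γ hγ z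
  have A2 := hA a ha hac ‖ξ‖ (norm_nonneg _) γ hγ (-ξ)
  simp only [sub_neg_eq_add] at A2
  set w := 1 + ‖z + ξ‖ ^ 2 with hw
  have hw1 : 1 ≤ w := by rw [hw]; nlinarith [norm_nonneg (z + ξ)]
  have hw0 : 0 < w := by linarith
  set B := (4 : ℝ) ^ ((m : ℝ) + 1) with hB
  have hB0 : 0 < B := by positivity
  calc _ ≤ ∫⁻ x : EuclideanSpace ℝ (Fin (2 * m + 3)),
        (ENNReal.ofReal (B * w ^ (-((m : ℝ) + a))) *
          ENNReal.ofReal (hfun γ ‖x‖ ‖ξ‖ ^ 2 * (1 + ‖x - z‖ ^ 2) ^ (-((m : ℝ) + b))) +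
        ENNReal.ofReal (B * w ^ (-((m : ℝ) + b))) *
          ENNReal.ofReal (hfun γ ‖x‖ ‖ξ‖ ^ 2 * (1 + ‖x + ξ‖ ^ 2) ^ (-((m : ℝ) + a)))) := by
        refine lintegral_mono fun x => ?_
        simp only
        rw [← ENNReal.ofReal_mul (by positivity), ← ENNReal.ofReal_mul (by positivity),
          ← ENNReal.ofReal_add (by positivity) (by positivity)]
        apply ENNReal.ofReal_le_ofReal
        have h := split_aux m (1 + ‖x + ξ‖ ^ 2) (1 + ‖z - x‖ ^ 2) w (m + a) (m + b)
          (by nlinarith [norm_nonneg (x + ξ)]) (by nlinarith [norm_nonneg (z - x)]) hw1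
          (tri_aux x ξ z) (by positivity) (by positivity) (by linarith) (by linarith)
        rw [norm_sub_rev x z]
        calc _ ≤ hfun γ ‖x‖ ‖ξ‖ ^ 2 * (B * (w ^ (-((m : ℝ) + a)) *
              (1 + ‖z - x‖ ^ 2) ^ (-((m : ℝ) + b)) + w ^ (-((m : ℝ) + b)) *
              (1 + ‖x + ξ‖ ^ 2) ^ (-((m : ℝ) + a)))) := by gcongr
          _ = _ := by ring
    _ = ENNReal.ofReal (B * w ^ (-((m : ℝ) + a))) *
          (∫⁻ x : EuclideanSpace ℝ (Fin (2 * m + 3)),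
          ENNReal.ofReal (hfun γ ‖x‖ ‖ξ‖ ^ 2 * (1 + ‖x - z‖ ^ 2) ^ (-((m : ℝ) + b)))) +
        ENNReal.ofReal (B * w ^ (-((m : ℝ) + b))) *
          ∫⁻ x : EuclideanSpace ℝ (Fin (2 * m + 3)),
          ENNReal.ofReal (hfun γ ‖x‖ ‖ξ‖ ^ 2 * (1 + ‖x + ξ‖ ^ 2) ^ (-((m : ℝ) + a))) := by
        unfold hfun
        rw [lintegral_add_left (by fun_prop), lintegral_const_mul _ (by fun_prop),
          lintegral_const_mul _ (by fun_prop)]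
    _ ≤ ENNReal.ofReal (B * w ^ (-((m : ℝ) + a))) *
          ENNReal.ofReal (K / γ * (1 + ‖ξ‖ ^ 2) ^ (-b)) +
        ENNReal.ofReal (B * w ^ (-((m : ℝ) + b))) *
          ENNReal.ofReal (K / γ * (1 + ‖ξ‖ ^ 2) ^ (-a)) := by gcongr
    _ = _ := by
        rw [← ENNReal.ofReal_mul (by positivity), ← ENNReal.ofReal_mul (by positivity),
          ← ENNReal.ofReal_add (by positivity) (by positivity)]
        congr 1
        ring

/-- the majorant -/
noncomputable def Phi {F : Type*} [NormedAddCommGroup F] (m : ℕ) (c : ℝ) (ξ z : F) : ℝ :=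
  (1 + ‖z + ξ‖ ^ 2) ^ (-(m : ℝ)) +
    (1 + ‖ξ‖ ^ 2) ^ c * (1 + ‖z + ξ‖ ^ 2) ^ (-((m : ℝ) + c))

theorem Phi_nonneg {F : Type*} [NormedAddCommGroup F] (m : ℕ) (c : ℝ) (ξ z : F) :
    0 ≤ Phi m c ξ z := by
  unfold Phi; positivity

theorem Phi_dom {F : Type*} [NormedAddCommGroup F] (m : ℕ) (c : ℝ) (ξ z : F) (b : ℝ)
    (hb : 0 ≤ b) (hbc : b ≤ c) :
    (1 + ‖z + ξ‖ ^ 2) ^ (-((m : ℝ) + b)) ≤ (1 + ‖ξ‖ ^ 2) ^ (-b) * Phi m c ξ z := by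
  unfold Phi
  set w := 1 + ‖z + ξ‖ ^ 2
  set κ := 1 + ‖ξ‖ ^ 2
  have hw : 0 < w := by positivity
  have hκ : 0 < κ := by positivity
  have e : ∀ x : ℝ, κ ^ x * w ^ (-((m : ℝ) + x)) = w ^ (-(m : ℝ)) * (κ / w) ^ x := by
    intro x
    rw [neg_add, Real.rpow_add hw, Real.div_rpow hκ.le hw.le, Real.rpow_neg hw.le x]
    field_simp
  rw [e c]
  have h1 : (κ / w) ^ b ≤ 1 + (κ / w) ^ c := by
    have hp : 0 < κ / w := by positivity
    rcases le_total 1 (κ / w) with h | h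
    · have := Real.rpow_le_rpow_of_exponent_le h hbc
      linarith
    · have := Real.rpow_le_one hp.le h hb
      have : 0 ≤ (κ / w) ^ c := by positivity
      linarith
  have h2 : κ ^ b * w ^ (-((m : ℝ) + b)) ≤
      w ^ (-(m : ℝ)) + w ^ (-(m : ℝ)) * (κ / w) ^ c := by
    rw [e b]
    have : 0 < w ^ (-(m : ℝ)) := by positivity
    nlinarith
  rw [Real.rpow_neg hκ.le, le_inv_mul_iff₀ (by positivity)]
  exact h2

theorem stepLemma (m : ℕ) (c : ℝ) (hc : 0 < c) (hc1 : c < 1) :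
    ∃ K : ℝ, 0 ≤ K ∧ ∀ b : ℝ, 0 ≤ b → b ≤ c → ∀ γ : ℝ, 0 < γ →
      ∀ ξ z : EuclideanSpace ℝ (Fin (2 * m + 3)),
      ∫⁻ x : EuclideanSpace ℝ (Fin (2 * m + 3)),
        ENNReal.ofReal (hfun γ ‖x‖ ‖ξ‖ ^ 2 * (Phi m c ξ x *
          (1 + ‖z - x‖ ^ 2) ^ (-((m : ℝ) + b)))) ≤
      ENNReal.ofReal (K / γ * ((1 + ‖ξ‖ ^ 2) ^ (-b) * Phi m c ξ z)) := by
  obtain ⟨K, hK, hB⟩ := lemB m c hc hc1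
  refine ⟨3 * K, by positivity, ?_⟩
  intro b hb hbc γ hγ ξ z
  have B1 := hB 0 le_rfl hc.le b hb hbc γ hγ ξ z
  have B2 := hB c hc.le le_rfl b hb hbc γ hγ ξ z
  have hd := Phi_dom m c ξ z b hb hbc
  simp only [add_zero, neg_zero, Real.rpow_zero, mul_one] at B1
  have hκ : 0 < 1 + ‖ξ‖ ^ 2 := by positivity
  have hκc : (1 + ‖ξ‖ ^ 2) ^ c * (1 + ‖ξ‖ ^ 2) ^ (-c) = 1 := by
    rw [← Real.rpow_add hκ]; simp
  calc _ = ∫⁻ x : EuclideanSpace ℝ (Fin (2 * m + 3)),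
        (ENNReal.ofReal (hfun γ ‖x‖ ‖ξ‖ ^ 2 * ((1 + ‖x + ξ‖ ^ 2) ^ (-(m : ℝ)) *
          (1 + ‖z - x‖ ^ 2) ^ (-((m : ℝ) + b)))) + ENNReal.ofReal ((1 + ‖ξ‖ ^ 2) ^ c) *
        ENNReal.ofReal (hfun γ ‖x‖ ‖ξ‖ ^ 2 * ((1 + ‖x + ξ‖ ^ 2) ^ (-((m : ℝ) + c)) *
          (1 + ‖z - x‖ ^ 2) ^ (-((m : ℝ) + b))))) := by
        refine lintegral_congr fun x => ?_
        rw [← ENNReal.ofReal_mul (by positivity),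
          ← ENNReal.ofReal_add (by positivity) (by positivity)]
        congr 1
        unfold Phi
        ring
    _ = (∫⁻ x : EuclideanSpace ℝ (Fin (2 * m + 3)),
        ENNReal.ofReal (hfun γ ‖x‖ ‖ξ‖ ^ 2 * ((1 + ‖x + ξ‖ ^ 2) ^ (-(m : ℝ)) *
          (1 + ‖z - x‖ ^ 2) ^ (-((m : ℝ) + b))))) + ENNReal.ofReal ((1 + ‖ξ‖ ^ 2) ^ c) *
        ∫⁻ x : EuclideanSpace ℝ (Fin (2 * m + 3)),
        ENNReal.ofReal (hfun γ ‖x‖ ‖ξ‖ ^ 2 * ((1 + ‖x + ξ‖ ^ 2) ^ (-((m : ℝ) + c)) *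
          (1 + ‖z - x‖ ^ 2) ^ (-((m : ℝ) + b)))) := by
        unfold hfun
        rw [lintegral_add_left (by fun_prop), lintegral_const_mul _ (by fun_prop)]
    _ ≤ _ := by
        refine (add_le_add B1 (mul_le_mul' le_rfl B2)).trans ?_
        rw [← ENNReal.ofReal_mul (by positivity),
          ← ENNReal.ofReal_add (by positivity) (by positivity)]
        apply ENNReal.ofReal_le_ofReal
        have e : K / γ * ((1 + ‖z + ξ‖ ^ 2) ^ (-(m : ℝ)) * (1 + ‖ξ‖ ^ 2) ^ (-b) +
            (1 + ‖z + ξ‖ ^ 2) ^ (-((m : ℝ) + b))) +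
          (1 + ‖ξ‖ ^ 2) ^ c * (K / γ * ((1 + ‖z + ξ‖ ^ 2) ^ (-((m : ℝ) + c)) *
            (1 + ‖ξ‖ ^ 2) ^ (-b) + (1 + ‖z + ξ‖ ^ 2) ^ (-((m : ℝ) + b)) *
              (1 + ‖ξ‖ ^ 2) ^ (-c))) =
          K / γ * ((1 + ‖ξ‖ ^ 2) ^ (-b) * Phi m c ξ z + (1 + ‖z + ξ‖ ^ 2) ^ (-((m : ℝ) + b)) +
            (1 + ‖z + ξ‖ ^ 2) ^ (-((m : ℝ) + b)) *
              ((1 + ‖ξ‖ ^ 2) ^ c * (1 + ‖ξ‖ ^ 2) ^ (-c))) := by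
          unfold Phi; ring
        rw [e, hκc, mul_one]
        have h0 : 0 ≤ K / γ := by positivity
        calc _ ≤ K / γ * ((1 + ‖ξ‖ ^ 2) ^ (-b) * Phi m c ξ z +
              (1 + ‖ξ‖ ^ 2) ^ (-b) * Phi m c ξ z + (1 + ‖ξ‖ ^ 2) ^ (-b) * Phi m c ξ z) := by
              gcongr
          _ = _ := by ring

/-- extension of a finite tuple by a constant -/
noncomputable def Yext {F : Type*} (L : ℕ) (y : Fin L → F) (z : F) (j : ℕ) : F :=
  if h : j < L then y ⟨j, h⟩ else z

theorem Yext_meas {F : Type*} [MeasurableSpace F] (L j : ℕ) :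
    Measurable (fun w : F × (Fin L → F) => Yext L w.2 w.1 j) := by
  unfold Yext
  split_ifs <;> fun_prop

/-- the chain integrand -/
noncomputable def Qc {F : Type*} [NormedAddCommGroup F] (γ : ℝ) (ξ : F) (p : ℕ → ℝ) (L : ℕ)
    (y : Fin L → F) (z : F) : ℝ :=
  (∏ j, hfun γ ‖y j‖ ‖ξ‖) ^ 2 * ((1 + ‖Yext L y z 0 + ξ‖ ^ 2) ^ (-(p 0)) *
    ∏ j ∈ Finset.Ico 1 (L + 1), (1 + ‖Yext L y z j - Yext L y z (j - 1)‖ ^ 2) ^ (-(p j)))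

theorem Qc_nonneg {F : Type*} [NormedAddCommGroup F] (γ : ℝ) (ξ : F) (p : ℕ → ℝ) (L : ℕ)
    (y : Fin L → F) (z : F) : 0 ≤ Qc γ ξ p L y z := by
  unfold Qc
  have : 0 ≤ ∏ j ∈ Finset.Ico 1 (L + 1),
    (1 + ‖Yext L y z j - Yext L y z (j - 1)‖ ^ 2) ^ (-(p j)) :=
    Finset.prod_nonneg fun j _ => by positivity
  positivity

theorem Qc_meas {F : Type*} [NormedAddCommGroup F] [MeasurableSpace F] [BorelSpace F]
    [SecondCountableTopology F] (γ : ℝ) (ξ : F) (p : ℕ → ℝ) (L : ℕ) :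
    Measurable (fun w : F × (Fin L → F) => Qc γ ξ p L w.2 w.1) := by
  have := fun j => Yext_meas (F := F) L j
  unfold Qc hfun
  fun_prop

theorem Qc_succ {F : Type*} [NormedAddCommGroup F] (γ : ℝ) (ξ : F) (p : ℕ → ℝ) (L : ℕ)
    (y : Fin (L + 1) → F) (z : F) :
    Qc γ ξ p (L + 1) y z = (hfun γ ‖y (Fin.last L)‖ ‖ξ‖ ^ 2 *
      (1 + ‖z - y (Fin.last L)‖ ^ 2) ^ (-(p (L + 1)))) *
      Qc γ ξ p L (fun j => y ((Fin.last L).succAbove j)) (y (Fin.last L)) := by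
  have hY : ∀ j, j ≤ L → Yext (L + 1) y z j =
      Yext L (fun j => y ((Fin.last L).succAbove j)) (y (Fin.last L)) j := by
    intro j hj
    unfold Yext
    rw [dif_pos (by omega)]
    split_ifs with h
    · rw [Fin.succAbove_last]; rfl
    · congr 1; ext; simp; omega
  have hlast : Yext (L + 1) y z (L + 1) = z := by unfold Yext; simp
  have hL : Yext (L + 1) y z L = y (Fin.last L) := by
    unfold Yext; rw [dif_pos (by omega)]; rfl
  unfold Qc
  rw [Finset.prod_Ico_succ_top (by omega : 1 ≤ L + 1), Fin.prod_univ_castSucc, hY 0 (by omega),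
    hlast, Nat.add_sub_cancel, hL]
  have : ∏ j ∈ Finset.Ico 1 (L + 1),
      (1 + ‖Yext (L + 1) y z j - Yext (L + 1) y z (j - 1)‖ ^ 2) ^ (-(p j)) =
      ∏ j ∈ Finset.Ico 1 (L + 1),
      (1 + ‖Yext L (fun j => y ((Fin.last L).succAbove j)) (y (Fin.last L)) j -
        Yext L (fun j => y ((Fin.last L).succAbove j)) (y (Fin.last L)) (j - 1)‖ ^ 2)
          ^ (-(p j)) := by
    refine Finset.prod_congr rfl fun j hj => ?_
    rw [Finset.mem_Ico] at hj
    rw [hY j (by omega), hY (j - 1) (by omega)]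
  rw [this]
  simp only [Fin.succAbove_last]
  ring

theorem chain (m : ℕ) (c : ℝ) (hc : 0 < c) (hc1 : c < 1) :
    ∃ K : ℝ, 0 ≤ K ∧ ∀ γ : ℝ, 0 < γ → ∀ ξ : EuclideanSpace ℝ (Fin (2 * m + 3)),
      ∀ a : ℕ → ℝ, ∀ L : ℕ, (∀ j, j < L + 1 → 0 ≤ a j ∧ a j ≤ c) →
      ∀ z : EuclideanSpace ℝ (Fin (2 * m + 3)),
      ∫⁻ y : Fin L → EuclideanSpace ℝ (Fin (2 * m + 3)),
        ENNReal.ofReal (Qc γ ξ (fun j => (m : ℝ) + a j) L y z) ≤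
      ENNReal.ofReal ((K / γ) ^ L * ((1 + ‖ξ‖ ^ 2) ^ (-(∑ j ∈ Finset.range (L + 1), a j)) *
        Phi m c ξ z)) := by
  obtain ⟨K, hK, hS⟩ := stepLemma m c hc hc1
  refine ⟨K, hK, ?_⟩
  intro γ hγ ξ a L
  have hκ : 0 < 1 + ‖ξ‖ ^ 2 := by positivity
  induction L with
  | zero =>
    intro ha z
    rw [Measure.volume_pi_eq_dirac isEmptyElim, lintegral_dirac]
    apply ENNReal.ofReal_le_ofReal
    have := Phi_dom m c ξ z (a 0) (ha 0 (by omega)).1 (ha 0 (by omega)).2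
    simpa [Qc, Yext] using this
  | succ L ih =>
    intro ha z
    have hb := ha (L + 1) (by omega)
    have hsf : SigmaFinite (volume : Measure (EuclideanSpace ℝ (Fin (2 * m + 3)))) := inferInstance
    have hsf' : ∀ _ : Fin (L + 1),
      SigmaFinite (volume : Measure (EuclideanSpace ℝ (Fin (2 * m + 3)))) := fun _ => hsf
    have hmp := volume_preserving_piFinSuccAbove
      (fun _ : Fin (L + 1) => EuclideanSpace ℝ (Fin (2 * m + 3))) (Fin.last L)
    let G : EuclideanSpace ℝ (Fin (2 * m + 3)) × (Fin L → EuclideanSpace ℝ (Fin (2 * m + 3))) →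
      ENNReal := fun w => ENNReal.ofReal (hfun γ ‖w.1‖ ‖ξ‖ ^ 2 *
        (1 + ‖z - w.1‖ ^ 2) ^ (-((m : ℝ) + a (L + 1)))) *
        ENNReal.ofReal (Qc γ ξ (fun j => (m : ℝ) + a j) L w.2 w.1)
    have hG : Measurable G := by
      have := Qc_meas γ ξ (fun j => (m : ℝ) + a j) L
      simp only [G]
      unfold hfun
      fun_prop
    set R := (K / γ) ^ L * (1 + ‖ξ‖ ^ 2) ^ (-(∑ j ∈ Finset.range (L + 1), a j)) with hR
    have hR0 : 0 ≤ R := by positivity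
    calc _ = ∫⁻ y : Fin (L + 1) → EuclideanSpace ℝ (Fin (2 * m + 3)),
          G (MeasurableEquiv.piFinSuccAbove
            (fun _ : Fin (L + 1) => EuclideanSpace ℝ (Fin (2 * m + 3))) (Fin.last L) y) := by
          refine lintegral_congr fun y => ?_
          rw [Qc_succ, ENNReal.ofReal_mul (by positivity)]
          rfl
      _ = ∫⁻ w, G w := hmp.lintegral_comp hG
      _ = ∫⁻ x, ∫⁻ y, G (x, y) := lintegral_prod _ hG.aemeasurable
      _ ≤ ∫⁻ x, ENNReal.ofReal R * ENNReal.ofReal (hfun γ ‖x‖ ‖ξ‖ ^ 2 * (Phi m c ξ x *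
          (1 + ‖z - x‖ ^ 2) ^ (-((m : ℝ) + a (L + 1))))) := by
          refine lintegral_mono fun x => ?_
          simp only [G]
          rw [lintegral_const_mul']
          swap
          · exact ENNReal.ofReal_ne_top
          refine (mul_le_mul' le_rfl (ih (fun j hj => ha j (by omega)) x)).trans ?_
          rw [← ENNReal.ofReal_mul (by positivity), ← ENNReal.ofReal_mul hR0]
          apply ENNReal.ofReal_le_ofReal
          apply le_of_eq
          rw [hR]
          ring
      _ = ENNReal.ofReal R * ∫⁻ x, ENNReal.ofReal (hfun γ ‖x‖ ‖ξ‖ ^ 2 * (Phi m c ξ x *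
          (1 + ‖z - x‖ ^ 2) ^ (-((m : ℝ) + a (L + 1))))) :=
          lintegral_const_mul' _ _ ENNReal.ofReal_ne_top
      _ ≤ _ := by
          refine (mul_le_mul' le_rfl (hS _ hb.1 hb.2 γ hγ ξ z)).trans ?_
          rw [← ENNReal.ofReal_mul hR0]
          apply ENNReal.ofReal_le_ofReal
          apply le_of_eq
          rw [hR, Finset.sum_range_succ _ (L + 1), neg_add _ (a (L + 1)), Real.rpow_add hκ, pow_succ]
          ring

theorem one_le_prod_aux (t : Finset ℕ) (f : ℕ → ℝ) (hf : ∀ j, 1 ≤ f j) :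
    1 ≤ ∏ j ∈ t, f j := by
  calc (1 : ℝ) = ∏ j ∈ t, (1 : ℝ) := by simp
    _ ≤ _ := Finset.prod_le_prod (fun _ _ => zero_le_one) fun j _ => hf j

theorem prod_aux {F : Type*} [NormedAddCommGroup F] [NormedSpace ℝ F] (N : ℕ) (hN : 0 < N)
    (d : ℕ → F) (ξ : F)
    (hd : ∑ j ∈ Finset.range N, d j = (2 : ℝ) • ξ) (e : ℕ → ℝ) (b : ℝ) (hb : 0 ≤ b)
    (he : ∀ j ∈ Finset.range N, b ≤ e j) :
    ∏ j ∈ Finset.range N, (1 + ‖d j‖ ^ 2) ^ (-(e j)) ≤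
      (N : ℝ) ^ (2 * b) * (1 + 4 * ‖ξ‖ ^ 2) ^ (-b) := by
  have hN0 : (0 : ℝ) < N := by exact_mod_cast hN
  set P := ∏ j ∈ Finset.range N, (1 + ‖d j‖ ^ 2) with hP
  have hJ1 : ∀ j, 1 ≤ 1 + ‖d j‖ ^ 2 := fun j => by nlinarith [norm_nonneg (d j)]
  have hP1 : ∀ j ∈ Finset.range N, 1 + ‖d j‖ ^ 2 ≤ P := by
    intro j hj
    rw [hP, ← Finset.mul_prod_erase _ _ hj]
    have : 1 ≤ ∏ i ∈ (Finset.range N).erase j, (1 + ‖d i‖ ^ 2) :=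
      one_le_prod_aux _ _ hJ1
    nlinarith [hJ1 j]
  have hPge : 1 ≤ P := one_le_prod_aux _ _ hJ1
  have hdj : ∀ j ∈ Finset.range N, ‖d j‖ ≤ Real.sqrt (P - 1) := by
    intro j hj
    apply Real.le_sqrt_of_sq_le
    have := hP1 j hj
    linarith
  have h2 : 2 * ‖ξ‖ ≤ N * Real.sqrt (P - 1) := by
    have h3 : ‖(2 : ℝ) • ξ‖ = 2 * ‖ξ‖ := by rw [norm_smul]; simp
    rw [← h3, ← hd]
    refine (norm_sum_le _ _).trans ((Finset.sum_le_sum hdj).trans ?_)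
    simp
  have h4 : 1 + 4 * ‖ξ‖ ^ 2 ≤ (N : ℝ) ^ 2 * P := by
    have h5 : (2 * ‖ξ‖) ^ 2 ≤ (N * Real.sqrt (P - 1)) ^ 2 := by gcongr
    rw [mul_pow (N : ℝ), Real.sq_sqrt (by linarith)] at h5
    have h6 : (1 : ℝ) ≤ (N : ℝ) ^ 2 := by
      have : (1 : ℝ) ≤ N := by exact_mod_cast hN
      nlinarith
    nlinarith
  have hD : 0 < 1 + 4 * ‖ξ‖ ^ 2 := by positivity
  calc _ ≤ ∏ j ∈ Finset.range N, (1 + ‖d j‖ ^ 2) ^ (-b) := by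
        apply Finset.prod_le_prod
        · intro j _; positivity
        · intro j hj
          exact Real.rpow_le_rpow_of_exponent_le (hJ1 j) (by linarith [he j hj])
    _ = P ^ (-b) := by
        rw [hP, Real.finsetProd_rpow]
        intro j _; positivity
    _ ≤ ((1 + 4 * ‖ξ‖ ^ 2) / (N : ℝ) ^ 2) ^ (-b) := by
        apply Real.rpow_le_rpow_of_nonpos (by positivity) _ (by linarith)
        rw [div_le_iff₀ (by positivity)]
        linarith
    _ = _ := by
        rw [Real.div_rpow (by positivity) (by positivity), Real.rpow_neg (by positivity) b,
          Real.rpow_neg (by positivity : (0 : ℝ) ≤ (N : ℝ) ^ 2) b, ← Real.rpow_natCast (N : ℝ) 2,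
          ← Real.rpow_mul hN0.le]
        push_cast
        field_simp

/-- increments of the chain -/
noncomputable def incr {F : Type*} [NormedAddCommGroup F] (Y : ℕ → F) (ξ : F) (j : ℕ) : F :=
  if j = 0 then Y 0 + ξ else Y j - Y (j - 1)

theorem incr_sum {F : Type*} [NormedAddCommGroup F] [NormedSpace ℝ F] (Y : ℕ → F) (ξ : F) (L : ℕ)
    (hY : Y L = ξ) : ∑ j ∈ Finset.range (L + 1), incr Y ξ j = (2 : ℝ) • ξ := by
  rw [Finset.sum_range_succ']
  have : ∀ j, incr Y ξ (j + 1) = Y (j + 1) - Y j := by intro j; simp [incr]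
  simp only [this, Finset.sum_range_sub]
  rw [hY, incr, if_pos rfl, two_smul]
  abel

theorem incr_prod {F : Type*} [NormedAddCommGroup F] (Y : ℕ → F) (ξ : F) (L : ℕ) (p : ℕ → ℝ) :
    ∏ j ∈ Finset.range (L + 1), (1 + ‖incr Y ξ j‖ ^ 2) ^ (-(p j)) =
      (1 + ‖Y 0 + ξ‖ ^ 2) ^ (-(p 0)) *
        ∏ j ∈ Finset.Ico 1 (L + 1), (1 + ‖Y j - Y (j - 1)‖ ^ 2) ^ (-(p j)) := by
  rw [Finset.range_eq_Ico, Finset.prod_eq_prod_Ico_succ_bot (by omega)]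
  congr 1
  refine Finset.prod_congr rfl fun j hj => ?_
  rw [Finset.mem_Ico] at hj
  rw [incr, if_neg (by omega)]

theorem jap_sq {F : Type*} [NormedAddCommGroup F] (x : F) (s : ℝ) :
    (jap x ^ (-s)) ^ 2 = (1 + ‖x‖ ^ 2) ^ (-s) := by
  unfold jap
  rw [← Real.rpow_natCast, ← Real.rpow_mul (Real.sqrt_nonneg _), Real.sqrt_eq_rpow,
    ← Real.rpow_mul (by positivity)]
  congr 1
  push_cast
  ring

theorem Mfun_sq {F : Type*} [NormedAddCommGroup F] (L : ℕ) (s : ℕ → ℝ) (ξ : F) (y : Fin L → F) :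
    Mfun (L + 1) s (Yext L y ξ) ^ 2 =
      ∏ j ∈ Finset.range (L + 1), (1 + ‖incr (Yext L y ξ) ξ j‖ ^ 2) ^ (-(s j)) := by
  have hL : Yext L y ξ L = ξ := by simp [Yext]
  rw [incr_prod, Mfun, Nat.add_sub_cancel, hL, mul_pow, ← Finset.prod_pow, jap_sq]
  simp only [jap_sq]

theorem Qc_eq {F : Type*} [NormedAddCommGroup F] (γ : ℝ) (L : ℕ) (p : ℕ → ℝ) (ξ : F)
    (y : Fin L → F) :
    Qc γ ξ p L y ξ = (∏ j, hfun γ ‖y j‖ ‖ξ‖) ^ 2 *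
      ∏ j ∈ Finset.range (L + 1), (1 + ‖incr (Yext L y ξ) ξ j‖ ^ 2) ^ (-(p j)) := by
  rw [incr_prod, Qc]

theorem final_aux (m L : ℕ) (hL : 1 ≤ L) (c k K γ A b : ℝ) (Nb : ℝ) (hNb : 0 ≤ Nb) (hc : 0 ≤ c)
    (hK : 0 ≤ K) (hγ : 0 < γ) (hA0 : 0 ≤ A) (hA : A ≤ (L : ℝ) + 1) (B : ℝ) (hB : B ≤ b + m) :
    Nb * (1 + 4 * k ^ 2) ^ (-b) * ((K / γ) ^ L * ((1 + k ^ 2) ^ (-A) *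
      ((1 + 4 * k ^ 2) ^ (-(m : ℝ)) +
        (1 + k ^ 2) ^ c * (1 + 4 * k ^ 2) ^ (-((m : ℝ) + c))))) ≤
    (32 * K) ^ L * Nb * (γ ^ L)⁻¹ * (1 + 4 * k ^ 2) ^ (-B - A) := by
  have hκ : 0 < 1 + k ^ 2 := by positivity
  have hD : 0 < 1 + 4 * k ^ 2 := by positivity
  set κ := 1 + k ^ 2 with hκd
  set D := 1 + 4 * k ^ 2 with hDd
  have hD1 : 1 ≤ D := by rw [hDd]; nlinarith [sq_nonneg k]
  have hκD : κ ≤ D := by rw [hDd, hκd]; nlinarith [sq_nonneg k]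
  have hDκ : D / 4 ≤ κ := by rw [hDd, hκd]; nlinarith [sq_nonneg k]
  have h1 : κ ^ c * D ^ (-((m : ℝ) + c)) ≤ D ^ (-(m : ℝ)) := by
    calc _ ≤ D ^ c * D ^ (-((m : ℝ) + c)) := by gcongr
      _ = _ := by rw [← Real.rpow_add hD]; congr 1; ring
  have h2 : κ ^ (-A) ≤ 16 ^ L * D ^ (-A) := by
    calc κ ^ (-A) ≤ (D / 4) ^ (-A) :=
          Real.rpow_le_rpow_of_nonpos (by positivity) hDκ (by linarith)
      _ = 4 ^ A * D ^ (-A) := by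
          rw [Real.div_rpow hD.le (by norm_num), Real.rpow_neg (by norm_num : (0 : ℝ) ≤ 4),
            div_inv_eq_mul, mul_comm]
      _ ≤ 4 ^ ((2 * L : ℕ) : ℝ) * D ^ (-A) := by
          gcongr
          · norm_num
          · push_cast
            have : (1 : ℝ) ≤ L := by exact_mod_cast hL
            linarith
      _ = _ := by rw [Real.rpow_natCast, pow_mul]; norm_num
  have h3 : (2 : ℝ) ≤ 2 ^ L := by
    calc (2 : ℝ) = 2 ^ 1 := by norm_num
      _ ≤ 2 ^ L := by gcongr; norm_num
  calc _ ≤ Nb * D ^ (-b) * ((K / γ) ^ L * ((16 ^ L * D ^ (-A)) *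
        (D ^ (-(m : ℝ)) + D ^ (-(m : ℝ))))) := by gcongr
    _ = Nb * (K / γ) ^ L * 16 ^ L * 2 * (D ^ (-b) * D ^ (-A) * D ^ (-(m : ℝ))) := by ring
    _ = Nb * (K / γ) ^ L * 16 ^ L * 2 * D ^ (-(b + m) - A) := by
        rw [← Real.rpow_add hD, ← Real.rpow_add hD]; congr 2; ring
    _ ≤ Nb * (K / γ) ^ L * 16 ^ L * 2 ^ L * D ^ (-B - A) := by
        gcongr
    _ = _ := by
        rw [div_pow, mul_pow, show (32 : ℝ) = 16 * 2 by norm_num, mul_pow, div_eq_mul_inv]; ring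

theorem stmt_19 (n m : ℕ) (hn : n = 2 * m + 3) (ε : ℝ) (hε : 0 < ε) (hε1 : ε < 1) :
    ∃ C : ℝ, ∀ N : ℕ, (hN : 2 ≤ N) → ∀ s : ℕ → ℝ,
      (∀ j, j < N → (m : ℝ) ≤ s j) →
      ∀ γ : ℝ, 0 < γ → ∀ ξ : EuclideanSpace ℝ (Fin n),
        Tfun n N γ ξ s ≤
          C ^ (N - 1) *
            (N : ℝ) ^ (2 * (Finset.range N).inf'
                (Finset.nonempty_range_iff.mpr (by omega))
                (fun j => s j - min (s j - (m : ℝ)) (1 - ε) - (m : ℝ))) *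
            (γ ^ (N - 1))⁻¹ *
            (1 + 4 * ‖ξ‖ ^ 2) ^
              (-((Finset.range N).inf' (Finset.nonempty_range_iff.mpr (by omega))
                  (fun j => s j - min (s j - (m : ℝ)) (1 - ε))) -
                ∑ j ∈ Finset.range N, min (s j - (m : ℝ)) (1 - ε)) := by

  subst hn
  obtain ⟨K, hK, hchain⟩ := chain m (1 - ε) (by linarith) (by linarith)
  refine ⟨32 * K, ?_⟩
  intro N hN s hs γ hγ ξ
  obtain ⟨L, rfl⟩ : ∃ L, N = L + 1 := ⟨N - 1, by omega⟩
  have hL : 1 ≤ L := by omega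
  have hne : (Finset.range (L + 1)).Nonempty := ⟨0, by simp⟩
  set a : ℕ → ℝ := fun j => min (s j - (m : ℝ)) (1 - ε) with ha
  have ha0 : ∀ j, j < L + 1 → 0 ≤ a j ∧ a j ≤ 1 - ε := fun j hj =>
    ⟨le_min (by linarith [hs j hj]) (by linarith), min_le_right _ _⟩
  set b : ℝ := (Finset.range (L + 1)).inf' hne (fun j => s j - a j - (m : ℝ)) with hb
  have hb0 : 0 ≤ b := by
    rw [hb, Finset.le_inf'_iff]
    intro j _
    have : a j ≤ s j - m := min_le_left _ _
    linarith
  have hbj : ∀ j ∈ Finset.range (L + 1), b ≤ s j - a j - m := fun j hj =>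
    Finset.inf'_le (fun j => s j - a j - (m : ℝ)) hj
  set B : ℝ := (Finset.range (L + 1)).inf' hne (fun j => s j - a j) with hB
  have hBb : B ≤ b + m := by
    obtain ⟨j, hj, hje⟩ := Finset.exists_mem_eq_inf' hne (fun j => s j - a j - (m : ℝ))
    rw [hb, hje]
    have := Finset.inf'_le (fun j => s j - a j) hj
    linarith
  set A : ℝ := ∑ j ∈ Finset.range (L + 1), a j with hA
  have hA0 : 0 ≤ A := Finset.sum_nonneg fun j hj => (ha0 j (Finset.mem_range.mp hj)).1
  have hA1 : A ≤ (L : ℝ) + 1 := by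
    have : A ≤ ∑ j ∈ Finset.range (L + 1), (1 : ℝ) :=
      Finset.sum_le_sum fun j hj => by linarith [(ha0 j (Finset.mem_range.mp hj)).2]
    simpa using this
  have hch := hchain γ hγ ξ a L ha0 ξ
  set Nb : ℝ := ((L + 1 : ℕ) : ℝ) ^ (2 * b) with hNb
  have hNb0 : 0 ≤ Nb := by positivity
  have hpt : ∀ y : Fin L → EuclideanSpace ℝ (Fin (2 * m + 3)),
      (∏ j : Fin L, hfun γ ‖y j‖ ‖ξ‖) ^ 2 * Mfun (L + 1) s (Yext L y ξ) ^ 2 ≤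
        Nb * (1 + 4 * ‖ξ‖ ^ 2) ^ (-b) * Qc γ ξ (fun j => (m : ℝ) + a j) L y ξ := by
    intro y
    rw [Mfun_sq, Qc_eq]
    have h1 := prod_aux (L + 1) (by omega) (incr (Yext L y ξ) ξ) ξ
      (incr_sum _ _ _ (by simp [Yext])) (fun j => s j - a j - m) b hb0 hbj
    have h2 : ∏ j ∈ Finset.range (L + 1), (1 + ‖incr (Yext L y ξ) ξ j‖ ^ 2) ^ (-(s j)) =
        (∏ j ∈ Finset.range (L + 1), (1 + ‖incr (Yext L y ξ) ξ j‖ ^ 2) ^ (-(s j - a j - m))) *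
        ∏ j ∈ Finset.range (L + 1), (1 + ‖incr (Yext L y ξ) ξ j‖ ^ 2) ^ (-((m : ℝ) + a j)) := by
      rw [← Finset.prod_mul_distrib]
      refine Finset.prod_congr rfl fun j _ => ?_
      rw [← Real.rpow_add (by positivity)]
      congr 1; ring
    rw [h2]
    have h3 : 0 ≤ ∏ j ∈ Finset.range (L + 1),
        (1 + ‖incr (Yext L y ξ) ξ j‖ ^ 2) ^ (-((m : ℝ) + a j)) :=
      Finset.prod_nonneg fun j _ => by positivity
    calc _ ≤ (∏ j : Fin L, hfun γ ‖y j‖ ‖ξ‖) ^ 2 * ((Nb * (1 + 4 * ‖ξ‖ ^ 2) ^ (-b)) *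
          ∏ j ∈ Finset.range (L + 1),
            (1 + ‖incr (Yext L y ξ) ξ j‖ ^ 2) ^ (-((m : ℝ) + a j))) := by gcongr
      _ = _ := by ring
  have hT : Tfun (2 * m + 3) (L + 1) γ ξ s =
      ∫ y : Fin L → EuclideanSpace ℝ (Fin (2 * m + 3)),
        (∏ j : Fin L, hfun γ ‖y j‖ ‖ξ‖) ^ 2 * Mfun (L + 1) s (Yext L y ξ) ^ 2 := rfl
  have hZ0 : 0 ≤ Nb * (1 + 4 * ‖ξ‖ ^ 2) ^ (-b) := by positivity
  have hPhi0 := Phi_nonneg m (1 - ε) ξ ξ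
  have hmain : Tfun (2 * m + 3) (L + 1) γ ξ s ≤ Nb * (1 + 4 * ‖ξ‖ ^ 2) ^ (-b) *
      ((K / γ) ^ L * ((1 + ‖ξ‖ ^ 2) ^ (-A) * Phi m (1 - ε) ξ ξ)) := by
    rw [hT]
    refine (Real.le_norm_self _).trans ((norm_integral_le_lintegral_norm _).trans ?_)
    refine ENNReal.toReal_le_of_le_ofReal (by positivity) ?_
    calc _ ≤ ∫⁻ y : Fin L → EuclideanSpace ℝ (Fin (2 * m + 3)),
          ENNReal.ofReal (Nb * (1 + 4 * ‖ξ‖ ^ 2) ^ (-b)) *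
            ENNReal.ofReal (Qc γ ξ (fun j => (m : ℝ) + a j) L y ξ) := by
          refine lintegral_mono fun y => ?_
          simp only
          rw [← ENNReal.ofReal_mul hZ0, Real.norm_of_nonneg (by positivity)]
          exact ENNReal.ofReal_le_ofReal (hpt y)
      _ = ENNReal.ofReal (Nb * (1 + 4 * ‖ξ‖ ^ 2) ^ (-b)) *
          ∫⁻ y : Fin L → EuclideanSpace ℝ (Fin (2 * m + 3)),
            ENNReal.ofReal (Qc γ ξ (fun j => (m : ℝ) + a j) L y ξ) :=
          lintegral_const_mul' _ _ ENNReal.ofReal_ne_top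
      _ ≤ _ := by
          refine (mul_le_mul' le_rfl hch).trans ?_
          rw [← ENNReal.ofReal_mul hZ0]
  refine hmain.trans ?_
  have h2x : ‖ξ + ξ‖ ^ 2 = 4 * ‖ξ‖ ^ 2 := by
    rw [← two_smul ℝ ξ, norm_smul, mul_pow]; norm_num
  have hfin := final_aux m L hL (1 - ε) ‖ξ‖ K γ A b Nb hNb0 (by linarith) hK hγ hA0 hA1 B hBb
  unfold Phi
  rw [h2x]
  exact hfin
end
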